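/- arXiv:1903.07679 — 9 statements merged into one kernel-verified Lean document; each statement's English description precedes it below -/
import Mathlib

section
/- Let n and k_0 be positive integers and h a natural number. Define on (0,1) the function ψ_h(t) as the (n+k_0)-th iterated derivative of t ↦ (1−t)^{n+1} · Σ_{m=1}^∞ t^m / m^{k_0+h}. Then ψ_h is bounded on (0,1) if and only if h ≠ 0. -/
open Set

def PsiBd (a : ℕ → ℝ) : Prop := ∃ C : ℝ, ∃ p : ℕ, ∀ l : ℕ, |a l| ≤ C * ((l : ℝ) + 1) ^ p

def psiShift (a : ℕ → ℝ) : ℕ → ℝ := fun l => ((l : ℝ) + 1) * a (l + 1)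

noncomputable def psiSer (a : ℕ → ℝ) (t : ℝ) : ℝ := ∑' l : ℕ, a l * t ^ l

lemma PsiBd.shift {a : ℕ → ℝ} (ha : PsiBd a) : PsiBd (psiShift a) := by
  obtain ⟨C, p, h⟩ := ha
  have hC : 0 ≤ C := by simpa using (abs_nonneg _).trans (h 0)
  refine ⟨C * 2 ^ p, p + 1, fun l => ?_⟩
  have h1 := h (l + 1)
  push_cast at h1
  have h2 : ((l : ℝ) + 1 + 1) ^ p ≤ (2 * ((l : ℝ) + 1)) ^ p := by
    gcongr; have : (0 : ℝ) ≤ l := by positivity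
    linarith
  rw [psiShift, abs_mul, abs_of_nonneg (by positivity : (0 : ℝ) ≤ (l : ℝ) + 1)]
  calc ((l : ℝ) + 1) * |a (l + 1)| ≤ ((l : ℝ) + 1) * (C * (2 * ((l : ℝ) + 1)) ^ p) := by
        gcongr; exact h1.trans (by gcongr)
    _ = _ := by rw [mul_pow]; ring

lemma PsiBd.summable_abs {a : ℕ → ℝ} (ha : PsiBd a) {ρ : ℝ} (h0 : 0 ≤ ρ) (h1 : ρ < 1) :
    Summable (fun l => |a l| * ρ ^ l) := by
  obtain ⟨C, p, h⟩ := ha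
  have hC : 0 ≤ C := by simpa using (abs_nonneg _).trans (h 0)
  have hn : ‖ρ‖ < 1 := by rwa [Real.norm_of_nonneg h0]
  have s := ((summable_pow_mul_geometric_of_norm_lt_one p hn).add
    (summable_geometric_of_lt_one h0 h1)).mul_left (C * 2 ^ p)
  refine Summable.of_nonneg_of_le (fun l => by positivity) (fun l => ?_) s
  have h2 : ((l : ℝ) + 1) ^ p ≤ 2 ^ p * ((l : ℝ) ^ p + 1) := by
    rcases Nat.eq_zero_or_pos l with rfl | hl
    · simp
      have : (1 : ℝ) ≤ 2 ^ p := one_le_pow₀ (by norm_num)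
      have h3 : (0 : ℝ) ≤ 0 ^ p := by positivity
      nlinarith
    · have : (1 : ℝ) ≤ l := by exact_mod_cast hl
      calc ((l : ℝ) + 1) ^ p ≤ (2 * (l : ℝ)) ^ p := by gcongr; linarith
        _ = 2 ^ p * (l : ℝ) ^ p := mul_pow _ _ _
        _ ≤ _ := by gcongr; linarith
  calc |a l| * ρ ^ l ≤ C * (2 ^ p * ((l : ℝ) ^ p + 1)) * ρ ^ l := by
        gcongr; exact (h l).trans (by gcongr)
    _ = _ := by ring

lemma PsiBd.summable {a : ℕ → ℝ} (ha : PsiBd a) {t : ℝ} (ht : |t| < 1) :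
    Summable (fun l => a l * t ^ l) := by
  refine Summable.of_norm ?_
  simpa [abs_mul] using ha.summable_abs (abs_nonneg t) ht

lemma PsiBd.hasDerivAt {a : ℕ → ℝ} (ha : PsiBd a) {t : ℝ} (ht : |t| < 1) :
    HasDerivAt (psiSer a) (psiSer (psiShift a) t) t := by
  obtain ⟨ρ, hρ, hρ1⟩ := exists_between ht
  have hρ0 : 0 ≤ ρ := (abs_nonneg t).trans hρ.le
  have hu : Summable (fun l : ℕ => |a l| * (l * ρ ^ (l - 1))) := by
    rw [← summable_nat_add_iff 1]
    refine (ha.shift.summable_abs hρ0 hρ1).congr fun l => ?_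
    rw [psiShift, abs_mul, abs_of_nonneg (by positivity : (0 : ℝ) ≤ (l : ℝ) + 1)]
    push_cast
    ring
  have key := hasDerivAt_tsum_of_isPreconnected (g := fun l z => a l * z ^ l)
    (g' := fun l z => a l * (l * z ^ (l - 1))) (t := Ioo (-ρ) ρ) (y₀ := t) (y := t) hu isOpen_Ioo
    isPreconnected_Ioo (fun l y _ => (hasDerivAt_pow l y).const_mul (a l))
    (fun l y hy => by
      have : |y| ≤ ρ := (abs_lt.2 hy).le
      rw [Real.norm_eq_abs, abs_mul, abs_mul, abs_pow, Nat.abs_cast]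
      gcongr) (abs_lt.1 hρ) (ha.summable ht) (abs_lt.1 hρ)
  have hs : Summable (fun l : ℕ => a l * (l * t ^ (l - 1))) := by
    refine Summable.of_norm_bounded hu fun l => ?_
    rw [Real.norm_eq_abs, abs_mul, abs_mul, abs_pow, Nat.abs_cast]
    gcongr
  rw [hs.tsum_eq_zero_add] at key
  convert! key using 1
  simp only [psiSer, psiShift]
  simp
  congr 1; ext l; ring

lemma psi_iter_bd {a : ℕ → ℝ} (ha : PsiBd a) (r : ℕ) : PsiBd (psiShift^[r] a) := by
  induction r with
  | zero => exact ha
  | succ r ih => rw [Function.iterate_succ_apply']; exact ih.shift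

lemma psi_iter_deriv {a : ℕ → ℝ} (ha : PsiBd a) (r : ℕ) :
    ∀ t : ℝ, |t| < 1 → iteratedDeriv r (psiSer a) t = psiSer (psiShift^[r] a) t := by
  induction r with
  | zero => intro t _; simp
  | succ r ih =>
    intro t ht
    rw [iteratedDeriv_succ, Function.iterate_succ_apply', ← ((psi_iter_bd ha r).hasDerivAt ht).deriv]
    apply Filter.EventuallyEq.deriv_eq
    have : {t : ℝ | |t| < 1} ∈ nhds t := (isOpen_lt continuous_abs continuous_const).mem_nhds ht
    filter_upwards [this] with y hy using ih y hy

lemma psi_contDiffOn (r : ℕ) : ∀ {a : ℕ → ℝ}, PsiBd a →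
    ContDiffOn ℝ r (psiSer a) {t : ℝ | |t| < 1} := by
  have ho : IsOpen {t : ℝ | |t| < 1} := isOpen_lt continuous_abs continuous_const
  induction r with
  | zero =>
    intro a ha
    refine contDiffOn_zero.2 fun t ht => (ha.hasDerivAt ht).continuousAt.continuousWithinAt
  | succ r ih =>
    intro a ha
    push_cast
    rw [contDiffOn_succ_iff_deriv_of_isOpen ho]
    refine ⟨fun t ht => (ha.hasDerivAt ht).differentiableAt.differentiableWithinAt, by simp, ?_⟩
    exact (ih ha.shift).congr fun t ht => (ha.hasDerivAt ht).deriv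

lemma psi_iter_coeff (a : ℕ → ℝ) (r : ℕ) : ∀ l,
    psiShift^[r] a l = ((l + 1).ascFactorial r : ℝ) * a (l + r) := by
  induction r with
  | zero => simp
  | succ r ih =>
    intro l
    rw [Function.iterate_succ_apply', psiShift, ih, ← mul_assoc]
    congr 1
    · rw [Nat.ascFactorial_succ, ← Nat.succ_ascFactorial]
      push_cast
      rfl
    · congr 1; omega

lemma psi_pow_deriv (N j : ℕ) (t : ℝ) : iteratedDeriv j (fun t : ℝ => (1 - t) ^ N) t =
    (-1) ^ j * (N.descFactorial j : ℝ) * (1 - t) ^ (N - j) := by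
  have := congrFun (iteratedDeriv_comp_const_sub j (fun x : ℝ => x ^ N) 1) t
  simp at this
  rw [this]
  ring

noncomputable def psiA (s : ℕ) : ℕ → ℝ := fun l => 1 / (l : ℝ) ^ s

lemma psiA_bd (s : ℕ) : PsiBd (psiA s) := by
  refine ⟨1, 0, fun l => ?_⟩
  rw [psiA, abs_of_nonneg (by positivity)]
  rcases Nat.eq_zero_or_pos l with rfl | hl
  · rcases Nat.eq_zero_or_pos s with rfl | hs
    · simp
    · simp [hs.ne']
  · have : (1 : ℝ) ≤ (l : ℝ) ^ s := one_le_pow₀ (by exact_mod_cast hl)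
    simpa using inv_le_one_of_one_le₀ this

lemma psiA_coeff_nonneg (s r l : ℕ) : 0 ≤ psiShift^[r] (psiA s) l := by
  rw [psi_iter_coeff, psiA]; positivity

lemma psi_ser_eq {s : ℕ} (hs : 0 < s) {t : ℝ} (ht : |t| < 1) :
    ∑' m : ℕ, t ^ (m + 1) / ((m : ℝ) + 1) ^ s = psiSer (psiA s) t := by
  rw [psiSer, ((psiA_bd s).summable ht).tsum_eq_zero_add]
  simp [psiA, hs.ne', div_eq_mul_inv, mul_comm]

/-- the terms carrying a positive power of `1 - t` are bounded -/
lemma psi_term_bd (k h q : ℕ) (hk : 0 < k) {t : ℝ} (ht : t ∈ Ioo (0 : ℝ) 1) :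
    |(1 - t) ^ (q + 1) * psiSer (psiShift^[q + k] (psiA (k + h))) t| ≤ (q.factorial : ℝ) := by
  have ht1 : |t| < 1 := by rw [abs_of_pos ht.1]; exact ht.2
  have ht0 := ht.1.le
  have h1t : 0 < 1 - t := by linarith [ht.2]
  have hS := hasSum_choose_mul_geometric_of_norm_lt_one q (r := t) ht1
  have hle : psiSer (psiShift^[q + k] (psiA (k + h))) t
      ≤ (q.factorial : ℝ) * (1 / (1 - t) ^ (q + 1)) := by
    rw [← (hS.mul_left (q.factorial : ℝ)).tsum_eq, psiSer]
    refine Summable.tsum_le_tsum (fun l => ?_) ((psi_iter_bd (psiA_bd _) _).summable ht1)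
      (hS.mul_left _).summable
    rw [← mul_assoc]
    refine mul_le_mul_of_nonneg_right ?_ (by positivity)
    rw [psi_iter_coeff, psiA, mul_one_div]
    have hpos : (1 : ℝ) ≤ ((l + (q + k) : ℕ) : ℝ) := by
      exact_mod_cast (by omega : 1 ≤ l + (q + k))
    rw [div_le_iff₀ (by positivity)]
    have e1 : (l + 1).ascFactorial (q + k) ≤
        (q.factorial * (l + q).choose q) * (l + (q + k)) ^ k := by
      rw [← Nat.ascFactorial_mul_ascFactorial, Nat.ascFactorial_eq_factorial_mul_choose]
      refine Nat.mul_le_mul_left _ ?_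
      have := Nat.ascFactorial_le_pow_add (l + q) k
      rwa [show l + q + 1 = l + 1 + q by ring, add_assoc l q k] at this
    have e2 : (((l + 1).ascFactorial (q + k) : ℕ) : ℝ) ≤
        ((q.factorial : ℝ) * ((l + q).choose q : ℝ)) * ((l + (q + k) : ℕ) : ℝ) ^ k := by
      exact_mod_cast e1
    refine e2.trans ?_
    gcongr
    omega
  have hnn : 0 ≤ psiSer (psiShift^[q + k] (psiA (k + h))) t :=
    tsum_nonneg fun l => mul_nonneg (psiA_coeff_nonneg _ _ _) (by positivity)
  rw [abs_of_nonneg (by positivity)]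
  calc _ ≤ (1 - t) ^ (q + 1) * ((q.factorial : ℝ) * (1 / (1 - t) ^ (q + 1))) := by gcongr
    _ = _ := by field_simp

lemma psi_main (n k h : ℕ) : ∃ c : ℝ, c ≠ 0 ∧ ∃ B : ℝ, ∀ t ∈ Ioo (0 : ℝ) 1,
    |iteratedDeriv (n + (k + 1))
        (fun t : ℝ => (1 - t) ^ (n + 1) *
          ∑' m : ℕ, t ^ (m + 1) / ((m : ℝ) + 1) ^ ((k + 1) + h)) t
      - c * psiSer (psiShift^[k] (psiA ((k + 1) + h))) t| ≤ B := by
  set N := n + (k + 1) with hN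
  set a := psiA ((k + 1) + h) with ha
  let d : ℕ → ℝ := fun j => (N.choose j : ℝ) * ((-1) ^ j * ((n + 1).descFactorial j : ℝ))
  refine ⟨d (n + 1), ?_, ?_⟩
  · have h1 : (N.choose (n + 1) : ℝ) ≠ 0 := by
      exact_mod_cast (Nat.choose_pos (by omega)).ne'
    have h2 : ((n + 1).descFactorial (n + 1) : ℝ) ≠ 0 := by
      rw [Nat.descFactorial_self]; exact_mod_cast (Nat.factorial_pos _).ne'
    simp only [d]
    exact mul_ne_zero h1 (mul_ne_zero (pow_ne_zero _ (by norm_num)) h2)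
  refine ⟨∑ j ∈ (Finset.range (N + 1)).erase (n + 1), |d j| * ((n - j).factorial : ℝ), ?_⟩
  intro t ht
  have ht1 : |t| < 1 := by rw [abs_of_pos ht.1]; exact ht.2
  have hnhds : {t : ℝ | |t| < 1} ∈ nhds t :=
    (isOpen_lt continuous_abs continuous_const).mem_nhds ht1
  have e1 : iteratedDeriv N (fun t : ℝ => (1 - t) ^ (n + 1) *
          ∑' m : ℕ, t ^ (m + 1) / ((m : ℝ) + 1) ^ ((k + 1) + h)) t
      = iteratedDeriv N (fun t : ℝ => (1 - t) ^ (n + 1) * psiSer a t) t := by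
    apply Filter.EventuallyEq.iteratedDeriv_eq
    filter_upwards [hnhds] with y hy
    rw [psi_ser_eq (by omega) hy]
  have e2 : iteratedDeriv N (fun t : ℝ => (1 - t) ^ (n + 1) * psiSer a t) t
      = ∑ j ∈ Finset.range (N + 1), d j * ((1 - t) ^ (n + 1 - j) * psiSer (psiShift^[N - j] a) t) := by
    rw [iteratedDeriv_fun_mul (by fun_prop) ((psi_contDiffOn N (psiA_bd _)).contDiffAt hnhds)]
    refine Finset.sum_congr rfl fun j _ => ?_
    rw [psi_pow_deriv, psi_iter_deriv (psiA_bd _) _ t ht1]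
    simp only [d]
    ring
  have hmem : n + 1 ∈ Finset.range (N + 1) := by simp; omega
  rw [e1, e2, ← Finset.add_sum_erase _ _ hmem]
  have e3 : N - (n + 1) = k := by omega
  rw [e3, Nat.sub_self, pow_zero, one_mul, add_sub_cancel_left]
  refine (Finset.abs_sum_le_sum_abs _ _).trans (Finset.sum_le_sum fun j hj => ?_)
  rw [Finset.mem_erase, Finset.mem_range] at hj
  rw [abs_mul]
  rcases lt_or_gt_of_ne hj.1 with hlt | hgt
  · refine mul_le_mul_of_nonneg_left ?_ (abs_nonneg _)
    have := psi_term_bd (k + 1) h (n - j) (by omega) ht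
    rwa [show n - j + 1 = n + 1 - j by omega, show n - j + (k + 1) = N - j by omega] at this
  · have : d j = 0 := by simp [d, Nat.descFactorial_of_lt hgt]
    simp [this]

lemma psi_coeff_summable (k h : ℕ) (hh : h ≠ 0) :
    Summable (psiShift^[k] (psiA ((k + 1) + h))) := by
  have hs : Summable (fun l : ℕ => 1 / ((l + k : ℕ) : ℝ) ^ 2) :=
    (summable_nat_add_iff k).2 (Real.summable_one_div_nat_pow.2 one_lt_two)
  refine Summable.of_nonneg_of_le (psiA_coeff_nonneg _ _) (fun l => ?_) hs
  rw [psi_iter_coeff, psiA, mul_one_div]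
  rcases Nat.eq_zero_or_pos (l + k) with h0 | h0
  · rw [h0]; simp
  · have hpos : (1 : ℝ) ≤ ((l + k : ℕ) : ℝ) := by exact_mod_cast h0
    have e2 : (((l + 1).ascFactorial k : ℕ) : ℝ) ≤ ((l + k : ℕ) : ℝ) ^ k := by
      exact_mod_cast Nat.ascFactorial_le_pow_add l k
    rw [div_le_div_iff₀ (by positivity) (by positivity), one_mul]
    calc _ ≤ ((l + k : ℕ) : ℝ) ^ k * ((l + k : ℕ) : ℝ) ^ 2 := by gcongr
      _ = ((l + k : ℕ) : ℝ) ^ (k + 2) := by rw [pow_add]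
      _ ≤ _ := pow_le_pow_right₀ hpos (by omega)

lemma psi_coeff_not_summable (k : ℕ) :
    ¬ Summable (psiShift^[k] (psiA (k + 1))) := by
  intro hs
  apply Real.not_summable_one_div_natCast
  rw [← summable_nat_add_iff (k + 1)]
  rw [← summable_nat_add_iff 1] at hs
  refine Summable.of_nonneg_of_le (fun l => by positivity) (fun l => ?_)
    (hs.mul_left (((k : ℝ) + 1) ^ k))
  rw [psi_iter_coeff, psiA]
  have e1 : (((l + 1 + 1 : ℕ) : ℝ)) ^ k ≤ (((l + 1 + 1).ascFactorial k : ℕ) : ℝ) := by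
    exact_mod_cast Nat.pow_succ_le_ascFactorial (l + 1 + 1) k
  have e2 : ((l + (k + 1) : ℕ) : ℝ) ≤ ((k : ℝ) + 1) * ((l + 1 + 1 : ℕ) : ℝ) := by
    push_cast
    have h1 : (0 : ℝ) ≤ l := by positivity
    have h2 : (0 : ℝ) ≤ k := by positivity
    nlinarith [mul_nonneg h1 h2]
  rw [show l + 1 + k = l + (k + 1) by ring, mul_one_div, mul_div_assoc',
    div_le_div_iff₀ (by positivity) (by positivity), one_mul, pow_succ]
  gcongr
  calc _ ≤ (((k : ℝ) + 1) * ((l + 1 + 1 : ℕ) : ℝ)) ^ k := by gcongr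
    _ = ((k : ℝ) + 1) ^ k * ((l + 1 + 1 : ℕ) : ℝ) ^ k := mul_pow _ _ _
    _ ≤ _ := by gcongr

lemma psi_ser_bdd_iff (k h : ℕ) : (∃ M : ℝ, ∀ t ∈ Ioo (0 : ℝ) 1,
    |psiSer (psiShift^[k] (psiA ((k + 1) + h))) t| ≤ M) ↔ h ≠ 0 := by
  constructor
  · rintro ⟨M, hM⟩ rfl
    apply psi_coeff_not_summable k
    rw [add_zero] at hM
    refine summable_of_sum_range_le (c := M) (psiA_coeff_nonneg _ _) fun L => ?_
    have hlim : Filter.Tendsto (fun t : ℝ => ∑ l ∈ Finset.range L,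
        psiShift^[k] (psiA (k + 1)) l * t ^ l) (nhdsWithin 1 (Iio 1))
        (nhds (∑ l ∈ Finset.range L, psiShift^[k] (psiA (k + 1)) l * 1 ^ l)) := by
      apply tendsto_nhdsWithin_of_tendsto_nhds
      apply Continuous.tendsto
      fun_prop
    simp only [one_pow, mul_one] at hlim
    refine le_of_tendsto hlim ?_
    filter_upwards [Ioo_mem_nhdsLT (show (0 : ℝ) < 1 by norm_num)] with t ht
    have ht1 : |t| < 1 := by rw [abs_of_pos ht.1]; exact ht.2
    refine le_trans ?_ ((le_abs_self _).trans (hM t ht))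
    exact ((psi_iter_bd (psiA_bd _) _).summable ht1).sum_le_tsum _
      fun l _ => mul_nonneg (psiA_coeff_nonneg _ _ _) (pow_nonneg ht.1.le _)
  · intro hh
    have hs := psi_coeff_summable k h hh
    refine ⟨∑' l, psiShift^[k] (psiA ((k + 1) + h)) l, fun t ht => ?_⟩
    have ht1 : |t| < 1 := by rw [abs_of_pos ht.1]; exact ht.2
    rw [psiSer, abs_of_nonneg (tsum_nonneg fun l =>
      mul_nonneg (psiA_coeff_nonneg _ _ _) (pow_nonneg ht.1.le _))]
    refine Summable.tsum_le_tsum (fun l => ?_) ((psi_iter_bd (psiA_bd _) _).summable ht1) hs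
    exact mul_le_of_le_one_right (psiA_coeff_nonneg _ _ _) (pow_le_one₀ ht.1.le ht.2.le)

/-- Lemma 2.2: the `(n+k₀)`-th derivative of
`t ↦ (1-t)^(n+1) ∑_{m≥1} t^m / m^(k₀+h)` is bounded on `(0,1)` iff `h ≠ 0`. -/
theorem psi_h_bounded_iff (n k₀ : ℕ) (hn : 0 < n) (hk₀ : 0 < k₀) (h : ℕ) :
    (∃ M : ℝ, ∀ t ∈ Set.Ioo (0 : ℝ) 1,
      |iteratedDeriv (n + k₀)
        (fun t : ℝ => (1 - t) ^ (n + 1) *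
          ∑' m : ℕ, t ^ (m + 1) / ((m : ℝ) + 1) ^ (k₀ + h)) t| ≤ M) ↔ h ≠ 0 := by
  obtain ⟨k, rfl⟩ : ∃ k, k₀ = k + 1 := ⟨k₀ - 1, by omega⟩
  obtain ⟨c, hc, B, hB⟩ := psi_main n k h
  rw [← psi_ser_bdd_iff k h]
  constructor
  · rintro ⟨M, hM⟩
    refine ⟨(M + B) / |c|, fun t ht => ?_⟩
    rw [le_div_iff₀ (abs_pos.2 hc), mul_comm, ← abs_mul]
    have h1 := abs_le.1 (hM t ht)
    have h2 := abs_le.1 (hB t ht)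
    rw [abs_le]
    constructor <;> linarith [h1.1, h1.2, h2.1, h2.2]
  · rintro ⟨M, hM⟩
    refine ⟨|c| * M + B, fun t ht => ?_⟩
    have h0 : |c * psiSer (psiShift^[k] (psiA ((k + 1) + h))) t| ≤ |c| * M := by
      rw [abs_mul]; exact mul_le_mul_of_nonneg_left (hM t ht) (abs_nonneg _)
    have h1 := abs_le.1 h0
    have h2 := abs_le.1 (hB t ht)
    rw [abs_le]
    constructor <;> linarith [h1.1, h1.2, h2.1, h2.2]
end

section
/- Let n and k_0 be positive integers, r ≤ −k_0 an integer, and f_r, …, f_{−k_0} real numbers with f_{−k_0} ≠ 0. Define on (0,1) the function g_−(t) = (1−t)^{n+1} · Σ_{m=1}^∞ t^m · (Σ_{h=r}^{−k_0} f_h m^h). Then |g_−^{(n+k_0)}(t)| → +∞ as t → 1⁻; in particular the (n+k_0)-th iterated derivative of g_− is unbounded on (0,1). -/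
open Set Filter

namespace TYCZ

/-- power series function -/
noncomputable def F (a : ℕ → ℝ) (t : ℝ) : ℝ := ∑' m : ℕ, a m * t ^ m

/-- coefficient sequence of the derivative -/
def D (a : ℕ → ℝ) (m : ℕ) : ℝ := ((m : ℝ) + 1) * a (m + 1)

/-- coefficient sequence of the iterated derivative -/
def Dc (a : ℕ → ℝ) (i m : ℕ) : ℝ := ((m + 1).ascFactorial i : ℝ) * a (m + i)

/-- polynomial growth -/
def PG (a : ℕ → ℝ) : Prop := ∃ (C : ℝ) (k : ℕ), ∀ m, |a m| ≤ C * ((m + 1).ascFactorial k : ℝ)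

lemma PG.D {a : ℕ → ℝ} (h : PG a) : PG (D a) := by
  obtain ⟨C, k, h⟩ := h
  refine ⟨C, k + 1, fun m => ?_⟩
  have h1 := h (m + 1)
  have e : ((m + 1).ascFactorial (k + 1) : ℝ) = ((m : ℝ) + 1) * ((m + 1 + 1).ascFactorial k : ℝ) := by
    have := Nat.succ_ascFactorial (m + 1) k
    rw [Nat.ascFactorial_succ, ← this]
    push_cast; rfl
  rw [e, TYCZ.D, abs_mul, abs_of_nonneg (by positivity : (0 : ℝ) ≤ (m : ℝ) + 1)]
  calc _ ≤ ((m : ℝ) + 1) * (C * ((m + 1 + 1).ascFactorial k : ℝ)) := by gcongr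
    _ = _ := by ring

lemma Dc_D (a : ℕ → ℝ) (i : ℕ) : Dc (D a) i = Dc a (i + 1) := by
  ext m
  simp only [Dc, D, Nat.ascFactorial_succ]
  push_cast
  rw [show m + i + 1 = m + (i + 1) by ring]
  ring

lemma hasSum_asc (k : ℕ) {t : ℝ} (ht : |t| < 1) :
    HasSum (fun m : ℕ => ((m + 1).ascFactorial k : ℝ) * t ^ m)
      ((k.factorial : ℝ) * (1 / (1 - t) ^ (k + 1))) := by
  have := (hasSum_choose_mul_geometric_of_norm_lt_one k (r := t) ht).mul_left (k.factorial : ℝ)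
  have e : (fun m : ℕ => ((m + 1).ascFactorial k : ℝ) * t ^ m) =
      fun m : ℕ => (k.factorial : ℝ) * (((m + k).choose k : ℝ) * t ^ m) := by
    ext m
    rw [Nat.ascFactorial_eq_factorial_mul_choose]
    push_cast; ring
  rw [e]; exact this

lemma PG.summable_abs {a : ℕ → ℝ} (h : PG a) {t : ℝ} (ht : |t| < 1) :
    Summable fun m : ℕ => |a m| * |t| ^ m := by
  obtain ⟨C, k, h⟩ := h
  have hs := ((hasSum_asc k (t := |t|) (by rwa [abs_abs])).summable).mul_left C
  refine Summable.of_nonneg_of_le (fun m => by positivity) (fun m => ?_) hs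
  rw [← mul_assoc]
  gcongr
  exact h m

lemma PG.summable {a : ℕ → ℝ} (h : PG a) {t : ℝ} (ht : |t| < 1) :
    Summable fun m : ℕ => a m * t ^ m := by
  refine Summable.of_norm ?_
  simpa [abs_mul, abs_pow] using h.summable_abs ht

lemma F_hasDerivAt {a : ℕ → ℝ} (h : PG a) {t : ℝ} (ht : |t| < 1) :
    HasDerivAt (F a) (F (D a) t) t := by
  obtain ⟨ρ, h1, h2⟩ := exists_between ht
  have hρ0 : 0 < ρ := (abs_nonneg t).trans_lt h1
  have hρ : |ρ| < 1 := by rwa [abs_of_pos hρ0]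
  have hu : Summable fun m : ℕ => |a m| * (m * ρ ^ (m - 1)) := by
    rw [← summable_nat_add_iff 1]
    refine (h.D.summable_abs hρ).congr fun m => ?_
    rw [D, abs_mul, abs_of_pos hρ0, abs_of_nonneg (by positivity : (0 : ℝ) ≤ (m : ℝ) + 1)]
    simp only [Nat.add_sub_cancel]
    push_cast
    ring
  have key := hasDerivAt_tsum_of_isPreconnected (t := Ioo (-ρ) ρ) (y₀ := t) (y := t)
    (g := fun (m : ℕ) (x : ℝ) => a m * x ^ m)
    (g' := fun (m : ℕ) (x : ℝ) => a m * (m * x ^ (m - 1))) hu isOpen_Ioo isPreconnected_Ioo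
    (fun m y _ => (hasDerivAt_pow m y).const_mul (a m))
    (fun m y hy => by
      rw [norm_mul, norm_mul, norm_pow, Real.norm_eq_abs, Real.norm_natCast]
      have : ‖y‖ ≤ ρ := by rw [Real.norm_eq_abs]; exact (abs_lt.2 hy).le
      gcongr) (abs_lt.1 h1) (h.summable ht) (abs_lt.1 h1)
  have e : F (D a) t = ∑' m : ℕ, a m * (m * t ^ (m - 1)) := by
    have hs : Summable fun m : ℕ => a m * (m * t ^ (m - 1)) := by
      rw [← summable_nat_add_iff 1]
      refine (h.D.summable ht).congr fun m => ?_
      simp [D]; ring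
    rw [hs.tsum_eq_zero_add]
    simp only [F, D]
    simp
    refine tsum_congr fun m => ?_
    ring
  rw [e]
  exact key

lemma nhds_unit {t : ℝ} (ht : |t| < 1) : ∀ᶠ x in nhds t, |x| < 1 :=
  (continuous_abs.tendsto t).eventually (gt_mem_nhds ht)

lemma iteratedDeriv_F (i : ℕ) : ∀ {a : ℕ → ℝ}, PG a → ∀ {t : ℝ}, |t| < 1 →
    iteratedDeriv i (F a) t = F (Dc a i) t := by
  induction i with
  | zero => intro a _ t _; simp [F, Dc]
  | succ i ih =>
    intro a h t ht
    rw [iteratedDeriv_succ']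
    have : deriv (F a) =ᶠ[nhds t] F (D a) := by
      filter_upwards [nhds_unit ht] with x hx using (F_hasDerivAt h hx).deriv
    rw [this.iteratedDeriv_eq, ih h.D ht, Dc_D]

lemma contDiffOn_F (i : ℕ) : ∀ {a : ℕ → ℝ}, PG a → ContDiffOn ℝ i (F a) (Ioo (-1) 1) := by
  induction i with
  | zero =>
    intro a h
    simp only [Nat.cast_zero, contDiffOn_zero]
    exact fun x hx => (F_hasDerivAt h (abs_lt.2 hx)).continuousAt.continuousWithinAt
  | succ i ih =>
    intro a h
    push_cast
    rw [contDiffOn_succ_iff_deriv_of_isOpen isOpen_Ioo]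
    refine ⟨fun x hx => (F_hasDerivAt h (abs_lt.2 hx)).differentiableAt.differentiableWithinAt,
      by simp, (ih h.D).congr fun x hx => (F_hasDerivAt h (abs_lt.2 hx)).deriv⟩

lemma contDiffAt_F (i : ℕ) {a : ℕ → ℝ} (h : PG a) {t : ℝ} (ht : |t| < 1) :
    ContDiffAt ℝ i (F a) t :=
  (contDiffOn_F i h).contDiffAt (isOpen_Ioo.mem_nhds (abs_lt.1 ht))

/-- Leibniz -/
lemma leibniz (n N : ℕ) {a : ℕ → ℝ} (h : PG a) {t : ℝ} (ht : |t| < 1) :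
    iteratedDeriv N (fun t => (1 - t) ^ (n + 1) * F a t) t =
      ∑ j ∈ Finset.range (N + 1), (N.choose j : ℝ) *
        ((-1) ^ j * ((n + 1).descFactorial j * (1 - t) ^ (n + 1 - j))) * F (Dc a (N - j)) t := by
  have h1 : ContDiffAt ℝ N (fun t : ℝ => (1 - t) ^ (n + 1)) t := by fun_prop
  have := iteratedDeriv_mul h1 (contDiffAt_F N h ht)
  change iteratedDeriv N ((fun t => (1 - t) ^ (n + 1)) * F a) t = _
  rw [this]
  refine Finset.sum_congr rfl fun j _ => ?_
  rw [iteratedDeriv_F _ h ht]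
  have e := congrFun (iteratedDeriv_comp_const_sub (n := j) (s := (1 : ℝ)) (f := fun x : ℝ => x ^ (n + 1))) t
  rw [e, iteratedDeriv_pow, smul_eq_mul]

/-- bounded terms -/
lemma bounded_term {a : ℕ → ℝ} {C : ℝ} {k : ℕ}
    (h : ∀ m : ℕ, |a m| * (m : ℝ) ^ k ≤ C) (l : ℕ)
    {t : ℝ} (h0 : 0 < t) (h1 : t < 1) :
    |(1 - t) ^ (l + 1) * F (Dc a (l + k)) t| ≤ C * l.factorial := by
  have ht : |t| < 1 := by rwa [abs_of_pos h0]
  have hb : ∀ m, |Dc a (l + k) m| ≤ C * ((m + 1).ascFactorial l : ℝ) := by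
    intro m
    rw [Dc, ← Nat.ascFactorial_mul_ascFactorial, abs_mul, Nat.abs_cast]
    have h2 : ((m + 1 + l).ascFactorial k : ℝ) ≤ ((m + (l + k) : ℕ) : ℝ) ^ k := by
      have := Nat.ascFactorial_le_pow_add (m + l) k
      rw [show m + l + 1 = m + 1 + l by ring, show m + l + k = m + (l + k) by ring] at this
      exact_mod_cast this
    push_cast [Nat.cast_mul] at h2 ⊢
    have h3 := h (m + (l + k))
    push_cast at h3
    calc _ ≤ ((m + 1).ascFactorial l : ℝ) * ((m : ℝ) + (l + k)) ^ k * |a (m + (l + k))| := by gcongr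
      _ = ((m + 1).ascFactorial l : ℝ) * (|a (m + (l + k))| * ((m : ℝ) + (l + k)) ^ k) := by ring
      _ ≤ ((m + 1).ascFactorial l : ℝ) * C := by gcongr
      _ = _ := by ring
  have hs := (hasSum_asc l ht).mul_left C
  have : ‖F (Dc a (l + k)) t‖ ≤ C * ((l.factorial : ℝ) * (1 / (1 - t) ^ (l + 1))) := by
    refine tsum_of_norm_bounded hs fun m => ?_
    rw [norm_mul, norm_pow, Real.norm_eq_abs, Real.norm_eq_abs, abs_of_pos h0, ← mul_assoc]
    gcongr
    exact hb m
  have hp : 0 < (1 - t) ^ (l + 1) := pow_pos (by linarith) _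
  rw [abs_mul, abs_of_pos hp]
  calc _ ≤ (1 - t) ^ (l + 1) * (C * ((l.factorial : ℝ) * (1 / (1 - t) ^ (l + 1)))) := by
        gcongr; exact this
    _ = _ := by field_simp

/-- divergence -/
lemma diverge {b : ℕ → ℝ} (hb : PG b) {δ : ℝ} (hδ : 0 < δ)
    (h : ∀ᶠ m : ℕ in atTop, δ * (1 / ((m : ℝ) + 1)) ≤ b m) :
    Tendsto (F b) (nhdsWithin 1 (Iio 1)) atTop := by
  obtain ⟨M, hM⟩ := eventually_atTop.1 h
  rw [tendsto_atTop]
  intro B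
  have hdiv : Tendsto (fun P => ∑ m ∈ Finset.range P, b m) atTop atTop := by
    have hh := (Real.tendsto_sum_range_one_div_nat_succ_atTop.const_mul_atTop hδ)
    refine tendsto_atTop_mono' atTop ?_ (tendsto_atTop_add_const_right atTop
      (∑ m ∈ Finset.range M, (b m - δ * (1 / ((m : ℝ) + 1)))) hh)
    filter_upwards [eventually_ge_atTop M] with P hP
    have := Finset.sum_le_sum_of_subset_of_nonneg (f := fun m : ℕ => b m - δ * (1 / ((m : ℝ) + 1)))
      (Finset.range_mono hP) (fun i _ hi => by
        have := hM i (by simpa using hi); linarith)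
    have e : ∑ m ∈ Finset.range P, (b m - δ * (1 / ((m : ℝ) + 1))) =
      ∑ m ∈ Finset.range P, b m - δ * ∑ m ∈ Finset.range P, (1 / ((m : ℝ) + 1)) := by
      rw [Finset.sum_sub_distrib, Finset.mul_sum]
    linarith
  obtain ⟨P, hPB, hPM⟩ := ((hdiv.eventually_gt_atTop B).and (eventually_ge_atTop M)).exists
  have hc : Continuous fun t : ℝ => ∑ m ∈ Finset.range P, b m * t ^ m := by fun_prop
  have hev : ∀ᶠ t in nhdsWithin (1 : ℝ) (Iio 1), B < ∑ m ∈ Finset.range P, b m * t ^ m := by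
    refine (hc.continuousWithinAt (s := Iio 1) (x := 1)).eventually (lt_mem_nhds ?_)
    simpa using hPB
  filter_upwards [hev, Ioo_mem_nhdsLT (show (0 : ℝ) < 1 by norm_num)] with t h1 h2
  have hs := hb.summable (t := t) (by rw [abs_of_pos h2.1]; exact h2.2)
  refine h1.le.trans (hs.sum_le_tsum _ fun i hi => ?_)
  have h3 := hM i (by have : P ≤ i := by simpa using hi
                      omega)
  have : 0 ≤ b i := le_trans (by positivity) h3
  have := h2.1
  positivity

lemma PG.Dc {a : ℕ → ℝ} (h : PG a) (i : ℕ) : PG (Dc a i) := by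
  induction i generalizing a with
  | zero =>
    have e : TYCZ.Dc a 0 = a := by ext m; simp [TYCZ.Dc]
    rwa [e]
  | succ i ih => rw [← Dc_D]; exact ih h.D

lemma diverge_Dc {a : ℕ → ℝ} (ha : PG a) {k : ℕ} {c : ℝ} (hc : 0 < c)
    (h : Tendsto (fun m : ℕ => a m * (m : ℝ) ^ (k + 1)) atTop (nhds c)) :
    Tendsto (F (Dc a k)) (nhdsWithin 1 (Iio 1)) atTop := by
  refine diverge (ha.Dc k) (δ := c / 2 / ((k : ℝ) + 1) ^ (k + 1)) (by positivity) ?_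
  have h2 := (h.comp (tendsto_add_atTop_nat k)).eventually (lt_mem_nhds (half_lt_self hc))
  filter_upwards [h2, eventually_gt_atTop 0] with m hm hm0
  simp only [Function.comp] at hm
  have hq : (0 : ℝ) < ((m + k : ℕ) : ℝ) := by positivity
  have ha0 : c / 2 / ((m + k : ℕ) : ℝ) ^ (k + 1) ≤ a (m + k) := by
    rw [div_le_iff₀ (by positivity)]; exact hm.le
  have hasc : ((m : ℝ) + 1) ^ k ≤ ((m + 1).ascFactorial k : ℝ) := by
    exact_mod_cast Nat.pow_succ_le_ascFactorial (m + 1) k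
  have hmk : ((m + k : ℕ) : ℝ) ≤ ((k : ℝ) + 1) * ((m : ℝ) + 1) := by
    push_cast; nlinarith [(Nat.cast_nonneg k : (0 : ℝ) ≤ k), (Nat.cast_nonneg m : (0 : ℝ) ≤ m)]
  calc c / 2 / ((k : ℝ) + 1) ^ (k + 1) * (1 / ((m : ℝ) + 1))
      = ((m : ℝ) + 1) ^ k * (c / 2 / (((k : ℝ) + 1) * ((m : ℝ) + 1)) ^ (k + 1)) := by
        rw [mul_pow, pow_succ ((m : ℝ) + 1)]; field_simp
    _ ≤ ((m + 1).ascFactorial k : ℝ) * (c / 2 / ((m + k : ℕ) : ℝ) ^ (k + 1)) := by gcongr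
    _ ≤ ((m + 1).ascFactorial k : ℝ) * a (m + k) := by gcongr

lemma F_neg (a : ℕ → ℝ) (t : ℝ) : F (fun m => - a m) t = - F a t := by
  simp [F, tsum_neg]

lemma diverge_abs {a : ℕ → ℝ} (ha : PG a) {k : ℕ} {c : ℝ} (hc : c ≠ 0)
    (h : Tendsto (fun m : ℕ => a m * (m : ℝ) ^ (k + 1)) atTop (nhds c)) :
    Tendsto (fun t => |F (Dc a k) t|) (nhdsWithin 1 (Iio 1)) atTop := by
  rcases hc.lt_or_gt with hc | hc
  · have ha' : PG (fun m => - a m) := by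
      obtain ⟨C, k, h⟩ := ha
      exact ⟨C, k, by simpa using h⟩
    have := diverge_Dc ha' (k := k) (c := -c) (by linarith) (by simpa using h.neg)
    refine tendsto_atTop_mono (fun t => ?_) this
    have e : Dc (fun m => - a m) k = fun m => - Dc a k m := by ext m; simp [Dc]
    rw [e, F_neg]
    exact neg_le_abs _
  · exact tendsto_atTop_mono (fun t => le_abs_self _) (diverge_Dc ha hc h)

/-- The main analytic statement. -/
lemma main (n k : ℕ) {a : ℕ → ℝ} {C c : ℝ} (ha : PG a) (hc : c ≠ 0)
    (hC : ∀ m : ℕ, |a m| * (m : ℝ) ^ (k + 1) ≤ C)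
    (h : Tendsto (fun m : ℕ => a m * (m : ℝ) ^ (k + 1)) atTop (nhds c)) :
    Tendsto (fun t => |iteratedDeriv (n + (k + 1)) (fun t => (1 - t) ^ (n + 1) * F a t) t|)
      (nhdsWithin 1 (Iio 1)) atTop := by
  set N := n + (k + 1) with hN
  let T : ℕ → ℝ → ℝ := fun j t => (N.choose j : ℝ) *
        ((-1) ^ j * ((n + 1).descFactorial j * (1 - t) ^ (n + 1 - j))) * F (Dc a (N - j)) t
  have hT : ∀ j, j ≠ n + 1 → ∃ M : ℝ, ∀ t ∈ Ioo (0 : ℝ) 1, |T j t| ≤ M := by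
    intro j hj
    rcases hj.lt_or_gt with hj | hj
    · obtain ⟨l, hl⟩ : ∃ l, n = j + l := ⟨n - j, by omega⟩
      refine ⟨(N.choose j : ℝ) * (n + 1).descFactorial j * (C * l.factorial), fun t ht => ?_⟩
      have hb := bounded_term hC l ht.1 ht.2
      have e1 : n + 1 - j = l + 1 := by omega
      have e2 : N - j = l + (k + 1) := by omega
      simp only [T, e1, e2]
      calc _ = (N.choose j : ℝ) * (n + 1).descFactorial j *
            |(1 - t) ^ (l + 1) * F (Dc a (l + (k + 1))) t| := by
            simp only [abs_mul, abs_pow, abs_neg, abs_one, one_pow, Nat.abs_cast]; ring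
        _ ≤ _ := by gcongr
    · refine ⟨0, fun t _ => ?_⟩
      simp [T, Nat.descFactorial_of_lt hj]
  choose! M hM using hT
  set s := (Finset.range (N + 1)).erase (n + 1) with hs
  set K : ℝ := (N.choose (n + 1) : ℝ) * (n + 1).factorial with hK
  have hKpos : 0 < K := by
    have : 0 < N.choose (n + 1) := Nat.choose_pos (by omega)
    have := Nat.factorial_pos (n + 1)
    positivity
  have hlim := tendsto_atTop_add_const_right _ (-∑ j ∈ s, M j)
    ((diverge_abs ha hc h).const_mul_atTop hKpos)
  refine tendsto_atTop_mono' _ ?_ hlim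
  filter_upwards [Ioo_mem_nhdsLT (show (0 : ℝ) < 1 by norm_num)] with t ht
  have ht1 : |t| < 1 := by rw [abs_of_pos ht.1]; exact ht.2
  have hL := leibniz n N ha ht1
  have hmem : n + 1 ∈ Finset.range (N + 1) := by simp; omega
  rw [← Finset.add_sum_erase _ _ hmem] at hL
  have hR : |∑ j ∈ s, T j t| ≤ ∑ j ∈ s, M j :=
    (Finset.abs_sum_le_sum_abs _ _).trans
      (Finset.sum_le_sum fun j hj => hM j (Finset.ne_of_mem_erase hj) t ht)
  have hmain : |T (n + 1) t| = K * |F (Dc a k) t| := by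
    have e2 : N - (n + 1) = k := by omega
    simp only [T, e2, abs_mul, hK, Nat.descFactorial_self, abs_pow, abs_neg, abs_one, one_pow,
      Nat.abs_cast, Nat.sub_self, pow_zero, mul_one, one_mul]
  rw [hL]
  change _ ≤ |T (n + 1) t + ∑ j ∈ s, T j t|
  have h3 := abs_sub_abs_le_abs_sub (T (n + 1) t) (-∑ j ∈ s, T j t)
  rw [abs_neg, sub_neg_eq_add] at h3
  linarith

end TYCZ

/-- The negative-degree part of a finite TYCZ expansion yields an unbounded
`(n+k₀)`-th derivative of the generating function
`g₋(t) = (1-t)^(n+1) ∑_{m≥1} t^m ∑_{h=r}^{-k₀} f_h m^h`: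
`|g₋^{(n+k₀)}(t)| → +∞` as `t → 1⁻`, in particular it is unbounded on `(0,1)`. -/
theorem gminus_derivative_unbounded (n k₀ : ℕ) (hn : 0 < n) (hk₀ : 0 < k₀)
    (r : ℤ) (hr : r ≤ -(k₀ : ℤ)) (f : ℤ → ℝ) (hf : f (-(k₀ : ℤ)) ≠ 0) :
    Filter.Tendsto
      (fun t : ℝ => |iteratedDeriv (n + k₀)
        (fun t : ℝ => (1 - t) ^ (n + 1) *
          ∑' m : ℕ, t ^ (m + 1) *
            ∑ h ∈ Finset.Icc r (-(k₀ : ℤ)), f h * ((m : ℝ) + 1) ^ h) t|)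
      (nhdsWithin 1 (Set.Iio 1)) Filter.atTop ∧
    ¬ ∃ M : ℝ, ∀ t ∈ Set.Ioo (0 : ℝ) 1,
      |iteratedDeriv (n + k₀)
        (fun t : ℝ => (1 - t) ^ (n + 1) *
          ∑' m : ℕ, t ^ (m + 1) *
            ∑ h ∈ Finset.Icc r (-(k₀ : ℤ)), f h * ((m : ℝ) + 1) ^ h) t| ≤ M := by
  obtain ⟨k, rfl⟩ : ∃ k, k₀ = k + 1 := ⟨k₀ - 1, by omega⟩
  set I := Finset.Icc r (-((k + 1 : ℕ) : ℤ)) with hI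
  set a : ℕ → ℝ := fun m => ∑ h ∈ I, f h * (m : ℝ) ^ h with ha
  have hIle : ∀ h ∈ I, h ≤ -((k + 1 : ℕ) : ℤ) := fun h hh => (Finset.mem_Icc.1 hh).2
  have ha0 : a 0 = 0 := by
    refine Finset.sum_eq_zero fun h hh => ?_
    have := hIle h hh
    rw [Nat.cast_zero, zero_zpow h (by omega), mul_zero]
  have hpos : ∀ m : ℕ, 0 < m → a m * (m : ℝ) ^ (k + 1) =
      ∑ h ∈ I, f h * (m : ℝ) ^ (h + ((k + 1 : ℕ) : ℤ)) := by
    intro m hm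
    have hm' : (m : ℝ) ≠ 0 := by positivity
    simp only [ha, Finset.sum_mul]
    refine Finset.sum_congr rfl fun h _ => ?_
    rw [zpow_add₀ hm', zpow_natCast, mul_assoc]
  have hC : ∀ m : ℕ, |a m| * (m : ℝ) ^ (k + 1) ≤ ∑ h ∈ I, |f h| := by
    intro m
    rcases Nat.eq_zero_or_pos m with rfl | hm
    · rw [ha0]; simp; positivity
    · have e : |a m| * (m : ℝ) ^ (k + 1) = |a m * (m : ℝ) ^ (k + 1)| := by
        rw [abs_mul, abs_of_nonneg (by positivity : (0 : ℝ) ≤ (m : ℝ) ^ (k + 1))]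
      rw [e, hpos m hm]
      refine (Finset.abs_sum_le_sum_abs _ _).trans (Finset.sum_le_sum fun h hh => ?_)
      have h1 : (m : ℝ) ^ (h + ((k + 1 : ℕ) : ℤ)) ≤ 1 :=
        zpow_le_one_of_nonpos₀ (by exact_mod_cast hm) (by have := hIle h hh; omega)
      have h0 : (0 : ℝ) ≤ (m : ℝ) ^ (h + ((k + 1 : ℕ) : ℤ)) := by positivity
      rw [abs_mul, abs_of_nonneg h0]
      exact mul_le_of_le_one_right (abs_nonneg _) h1
  have hPG : TYCZ.PG a := by
    refine ⟨∑ h ∈ I, |f h|, 0, fun m => ?_⟩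
    rw [Nat.ascFactorial_zero, Nat.cast_one, mul_one]
    rcases Nat.eq_zero_or_pos m with rfl | hm
    · rw [ha0]; simp; positivity
    · refine le_trans ?_ (hC m)
      exact le_mul_of_one_le_right (abs_nonneg _) (one_le_pow₀ (by exact_mod_cast hm))
  have hlim : Tendsto (fun m : ℕ => a m * (m : ℝ) ^ (k + 1)) atTop
      (nhds (f (-((k + 1 : ℕ) : ℤ)))) := by
    have h1 : Tendsto (fun m : ℕ => ∑ h ∈ I, f h * (m : ℝ) ^ (h + ((k + 1 : ℕ) : ℤ))) atTop
        (nhds (∑ h ∈ I, if h = -((k + 1 : ℕ) : ℤ) then f h else 0)) := by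
      refine tendsto_finsetSum _ fun h hh => ?_
      have hle := hIle h hh
      split_ifs with heq
      · rw [heq]; simp
      · have hz := (tendsto_zpow_atTop_zero (𝕜 := ℝ) (n := h + ((k + 1 : ℕ) : ℤ)) (by omega)).comp
          (tendsto_natCast_atTop_atTop (R := ℝ))
        simpa using hz.const_mul (f h)
    rw [Finset.sum_ite_eq' I, if_pos (Finset.mem_Icc.2 ⟨hr, le_refl _⟩)] at h1
    refine h1.congr' ?_
    filter_upwards [eventually_gt_atTop 0] with m hm using (hpos m hm).symm
  have key := TYCZ.main n k hPG hf hC hlim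
  have hfin : Filter.Tendsto
      (fun t : ℝ => |iteratedDeriv (n + (k + 1))
        (fun t : ℝ => (1 - t) ^ (n + 1) *
          ∑' m : ℕ, t ^ (m + 1) * ∑ h ∈ I, f h * ((m : ℝ) + 1) ^ h) t|)
      (nhdsWithin 1 (Set.Iio 1)) Filter.atTop := by
    refine key.congr' ?_
    filter_upwards [Ioo_mem_nhdsLT (show (0 : ℝ) < 1 by norm_num)] with t ht
    have ht1 : |t| < 1 := by rw [abs_of_pos ht.1]; exact ht.2
    congr 1
    refine Filter.EventuallyEq.iteratedDeriv_eq _ ?_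
    filter_upwards [TYCZ.nhds_unit ht1] with x hx
    congr 1
    rw [TYCZ.F, (hPG.summable hx).tsum_eq_zero_add, ha0, zero_mul, zero_add]
    refine tsum_congr fun m => ?_
    simp only [ha]
    push_cast
    ring
  refine ⟨hfin, ?_⟩
  rintro ⟨M, hM⟩
  obtain ⟨t, h1, h2⟩ := ((hfin.eventually_gt_atTop M).and
    (Ioo_mem_nhdsLT (show (0 : ℝ) < 1 by norm_num))).exists
  exact absurd (hM t h2) (not_le.2 h1)
end

section
/- Let n be a natural number and f : ℤ → ℝ a finitely supported function; set T_m = Σ_{h∈ℤ} f(h) m^h for integers m ≥ 1. Assume: (i) there exists C > 0 with |T_m − m^n| ≤ C·m^{n−1} for all m ≥ 1; and (ii) for every natural number h, the h-th iterated derivative of φ(t) = (1−t)^{n+1} Σ_{m=1}^∞ t^m T_m is bounded on (0,1). Then f(h) = 0 for every integer h < 0 and every integer h > n, and f(n) = 1; that is, T_m is a monic polynomial in m of degree n. -/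
open Set Filter

/-- Smooth functions on `(0,1)` with all derivatives bounded, given by a chain of derivatives. -/
def SB (f : ℝ → ℝ) : Prop :=
  ∃ F : ℕ → ℝ → ℝ, (∀ t ∈ Ioo (0:ℝ) 1, F 0 t = f t) ∧
    (∀ k, ∀ t ∈ Ioo (0:ℝ) 1, HasDerivAt (F k) (F (k+1) t) t) ∧
    (∀ k, ∃ M : ℝ, ∀ t ∈ Ioo (0:ℝ) 1, |F k t| ≤ M)

lemma SB.congr {f g : ℝ → ℝ} (hf : SB f) (h : ∀ t ∈ Ioo (0:ℝ) 1, f t = g t) : SB g := by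
  obtain ⟨F, h0, h1, h2⟩ := hf
  exact ⟨F, fun t ht => (h0 t ht).trans (h t ht), h1, h2⟩

lemma SB.add {f g : ℝ → ℝ} (hf : SB f) (hg : SB g) : SB (fun t => f t + g t) := by
  obtain ⟨F, h0, h1, h2⟩ := hf
  obtain ⟨G, g0, g1, g2⟩ := hg
  refine ⟨fun k t => F k t + G k t, fun t ht => by simp [h0 t ht, g0 t ht],
    fun k t ht => (h1 k t ht).add (g1 k t ht), fun k => ?_⟩
  obtain ⟨M, hM⟩ := h2 k
  obtain ⟨N, hN⟩ := g2 k
  exact ⟨M + N, fun t ht => (abs_add_le _ _).trans (add_le_add (hM t ht) (hN t ht))⟩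

lemma SB.smul {f : ℝ → ℝ} (c : ℝ) (hf : SB f) : SB (fun t => c * f t) := by
  obtain ⟨F, h0, h1, h2⟩ := hf
  refine ⟨fun k t => c * F k t, fun t ht => by simp [h0 t ht],
    fun k t ht => (h1 k t ht).const_mul c, fun k => ?_⟩
  obtain ⟨M, hM⟩ := h2 k
  exact ⟨|c| * M, fun t ht => by
    rw [abs_mul]; exact mul_le_mul_of_nonneg_left (hM t ht) (abs_nonneg c)⟩

lemma hd_congr {f g : ℝ → ℝ} {f' g' t : ℝ} (h : HasDerivAt f f' t) (hf : ∀ s, g s = f s)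
    (h' : g' = f') : HasDerivAt g g' t := by
  rw [h', funext hf]; exact h

lemma SB.mul_id {f : ℝ → ℝ} (hf : SB f) : SB (fun t => t * f t) := by
  obtain ⟨F, h0, h1, h2⟩ := hf
  refine ⟨fun k t => t * F k t + k * F (k-1) t, fun t ht => by simp [h0 t ht],
    fun k t ht => ?_, fun k => ?_⟩
  · have a := (hasDerivAt_id t).mul (h1 k t ht)
    rcases k with _ | k
    · refine hd_congr a (fun s => ?_) ?_
      · simp
      · simp; ring
    · have b := (h1 k t ht).const_mul ((k:ℝ)+1)
      refine hd_congr (a.add b) (fun s => ?_) ?_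
      · simp
      · simp; ring
  · obtain ⟨M, hM⟩ := h2 k
    obtain ⟨N, hN⟩ := h2 (k-1)
    refine ⟨M + k * N, fun t ht => (abs_add_le _ _).trans (add_le_add ?_ ?_)⟩
    · rw [abs_mul, abs_of_pos ht.1]
      have := hM t ht
      nlinarith [abs_nonneg (F k t), ht.2, ht.1]
    · rw [abs_mul, Nat.abs_cast]
      exact mul_le_mul_of_nonneg_left (hN t ht) (Nat.cast_nonneg k)

lemma SB.mul_one_sub {f : ℝ → ℝ} (hf : SB f) : SB (fun t => (1 - t) * f t) :=
  (hf.add ((hf.mul_id).smul (-1))).congr fun t _ => by ring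

lemma SB.deriv {f g : ℝ → ℝ} (hf : SB f) (h : ∀ t ∈ Ioo (0:ℝ) 1, HasDerivAt f (g t) t) :
    SB g := by
  obtain ⟨F, h0, h1, h2⟩ := hf
  refine ⟨fun k => F (k+1), fun t ht => ?_, fun k => h1 (k+1), fun k => h2 (k+1)⟩
  have : F 0 =ᶠ[nhds t] f := by
    filter_upwards [isOpen_Ioo.mem_nhds ht] with s hs using h0 s hs
  exact ((this.hasDerivAt_iff).1 (h1 0 t ht)).unique (h t ht)

lemma SB.const (c : ℝ) : SB (fun _ => c) := by
  refine ⟨fun k _ => if k = 0 then c else 0, fun t _ => by simp, fun k t _ => ?_, fun k => ?_⟩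
  · simpa using hasDerivAt_const t (if k = 0 then c else 0)
  · exact ⟨_, fun t _ => le_rfl⟩

lemma SB.one_sub_pow (N : ℕ) : SB (fun t => (1 - t) ^ N) := by
  induction N with
  | zero => exact (SB.const 1).congr fun t _ => by simp
  | succ N ih => exact ih.mul_one_sub.congr fun t _ => by ring

/-- Functions which land in `SB` after multiplication with a power of `1 - t`. -/
def SA (g : ℝ → ℝ) : Prop := ∃ N : ℕ, SB (fun t => (1 - t) ^ N * g t)

lemma SA.raise {g : ℝ → ℝ} {N : ℕ} (h : SB (fun t => (1 - t) ^ N * g t)) (M : ℕ) :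
    SB (fun t => (1 - t) ^ (N + M) * g t) := by
  induction M with
  | zero => exact h
  | succ M ih => exact ih.mul_one_sub.congr fun t _ => by ring

lemma SA.congr {f g : ℝ → ℝ} (hf : SA f) (h : ∀ t ∈ Ioo (0:ℝ) 1, f t = g t) : SA g := by
  obtain ⟨N, hN⟩ := hf
  exact ⟨N, hN.congr fun t ht => by rw [h t ht]⟩

lemma SA.add {f g : ℝ → ℝ} (hf : SA f) (hg : SA g) : SA (fun t => f t + g t) := by
  obtain ⟨N, hN⟩ := hf
  obtain ⟨M, hM⟩ := hg
  refine ⟨N + M, ((SA.raise hN M).add (SA.raise hM N)).congr fun t _ => ?_⟩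
  rw [add_comm M N]; ring

lemma SA.smul {f : ℝ → ℝ} (c : ℝ) (hf : SA f) : SA (fun t => c * f t) := by
  obtain ⟨N, hN⟩ := hf
  exact ⟨N, (hN.smul c).congr fun t _ => by ring⟩

lemma SA.sum {ι : Type*} (s : Finset ι) (F : ι → ℝ → ℝ) (h : ∀ i ∈ s, SA (F i)) :
    SA (fun t => ∑ i ∈ s, F i t) := by
  classical
  induction s using Finset.induction_on with
  | empty => exact ⟨0, (SB.const 0).congr fun t _ => by simp⟩
  | insert a s ha ih =>
    refine ((h a (by simp)).add (ih fun i hi => h i (by simp [hi]))).congr fun t _ => ?_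
    rw [Finset.sum_insert ha]

lemma hasDerivAt_one_sub_pow_mul {g : ℝ → ℝ} {g' t : ℝ} (N : ℕ) (h : HasDerivAt g g' t) :
    HasDerivAt (fun t => (1 - t) ^ N * g t)
      ((1 - t) ^ N * g' - N * (1 - t) ^ (N - 1) * g t) t := by
  have a := (((hasDerivAt_id t).const_sub 1).pow N).mul h
  refine hd_congr a (fun s => ?_) ?_
  · simp
  · simp; ring

lemma SA.theta {g g' : ℝ → ℝ} (hg : SA g) (h : ∀ t ∈ Ioo (0:ℝ) 1, HasDerivAt g (g' t) t) :
    SA (fun t => t * g' t) := by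
  obtain ⟨N, hN⟩ := hg
  have h1 := (hN.deriv fun t ht => hasDerivAt_one_sub_pow_mul N (h t ht)).mul_one_sub
  refine ⟨N + 1, (h1.add (hN.smul N)).mul_id.congr fun t _ => ?_⟩
  rcases N with _ | N
  · simp; ring
  · simp; ring

lemma not_SA_log : ¬ SA (fun t => - Real.log (1 - t)) := by
  have hd : ∀ t ∈ Ioo (0:ℝ) 1, HasDerivAt (fun t => - Real.log (1 - t)) (1 / (1 - t)) t := by
    intro t ht
    have : (1 - t) ≠ 0 := by linarith [ht.2]
    have := (((hasDerivAt_id t).const_sub 1).log this).neg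
    refine hd_congr this (fun s => ?_) ?_
    · simp
    · simp [neg_div]
  rintro ⟨N, hN⟩
  induction N with
  | zero =>
    obtain ⟨F, h0, -, h2⟩ := hN
    obtain ⟨M, hM⟩ := h2 0
    have e : Real.exp (-(|M| + 1)) < 1 := by
      rw [Real.exp_lt_one_iff]; linarith [abs_nonneg M]
    have ht : 1 - Real.exp (-(|M| + 1)) ∈ Ioo (0:ℝ) 1 :=
      ⟨by linarith, by linarith [Real.exp_pos (-(|M| + 1))]⟩
    have := hM _ ht
    rw [h0 _ ht] at this
    simp only [pow_zero, one_mul, sub_sub_cancel, Real.log_exp, neg_neg] at this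
    linarith [le_abs_self (|M| + 1), le_abs_self M]
  | succ N ih =>
    apply ih
    have h1 := hN.deriv fun t ht => hasDerivAt_one_sub_pow_mul (N+1) (hd t ht)
    refine ((h1.add ((SB.one_sub_pow N).smul (-1))).smul (-1 / ((N:ℝ) + 1))).congr fun t ht => ?_
    have : (1 - t) ≠ 0 := by linarith [ht.2]
    have : (N:ℝ) + 1 ≠ 0 := by positivity
    simp only [Nat.add_sub_cancel]
    push_cast
    field_simp
    ring

/-- The polylogarithm-type sums. -/
noncomputable def GG (e : ℤ) (t : ℝ) : ℝ := ∑' m : ℕ, t ^ (m + 1) * ((m : ℝ) + 1) ^ e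

lemma GG_summable (e : ℤ) {t : ℝ} (ht : t ∈ Ioo (0:ℝ) 1) :
    Summable fun m : ℕ => t ^ (m + 1) * ((m : ℝ) + 1) ^ e := by
  have h := summable_pow_mul_geometric_of_norm_lt_one e.toNat (r := t)
    (by rw [Real.norm_eq_abs, abs_of_pos ht.1]; exact ht.2)
  have h := (summable_nat_add_iff 1).2 h
  refine Summable.of_nonneg_of_le (fun m => ?_) (fun m => ?_) h
  · have := ht.1; positivity
  · have h0 := ht.1
    rw [mul_comm]
    push_cast
    refine mul_le_mul_of_nonneg_right ?_ (by positivity)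
    rw [← zpow_natCast]
    exact zpow_le_zpow_right₀ (by linarith [Nat.cast_nonneg (α := ℝ) m]) (Int.self_le_toNat e)

lemma GG_summable' (e : ℤ) {t : ℝ} (ht : t ∈ Ioo (0:ℝ) 1) :
    Summable fun m : ℕ => t ^ m * ((m : ℝ) + 1) ^ e := by
  refine ((GG_summable e ht).mul_left t⁻¹).congr fun m => ?_
  have := ht.1.ne'
  rw [pow_succ]
  field_simp

lemma GG_hasDerivAt (e : ℤ) {t : ℝ} (ht : t ∈ Ioo (0:ℝ) 1) :
    HasDerivAt (GG e) (GG (e+1) t / t) t := by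
  obtain ⟨r, hr1, hr2⟩ := exists_between ht.2
  have hr : r ∈ Ioo (0:ℝ) 1 := ⟨ht.1.trans hr1, hr2⟩
  have := hasDerivAt_tsum_of_isPreconnected (g := fun (m:ℕ) (t:ℝ) => t ^ (m + 1) * ((m : ℝ) + 1) ^ e)
    (g' := fun (m:ℕ) (t:ℝ) => t ^ m * ((m : ℝ) + 1) ^ (e+1)) (t := Ioo 0 r) (y₀ := t) (y := t)
    (GG_summable' (e+1) hr) isOpen_Ioo isPreconnected_Ioo ?_ ?_ ⟨ht.1, hr1⟩ (GG_summable e ht)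
    ⟨ht.1, hr1⟩
  · refine hd_congr this (fun s => rfl) ?_
    rw [GG, ← tsum_div_const]
    refine tsum_congr fun m => ?_
    have := ht.1.ne'
    rw [pow_succ]
    field_simp
  · intro m y hy
    have := (hasDerivAt_pow (m+1) y).mul_const (((m : ℝ) + 1) ^ e)
    refine hd_congr this (fun s => rfl) ?_
    have : (m:ℝ) + 1 ≠ 0 := by positivity
    rw [zpow_add_one₀ this]
    push_cast
    ring
  · intro m y hy
    have := hy.1
    rw [Real.norm_eq_abs, abs_of_nonneg (by positivity)]
    exact mul_le_mul_of_nonneg_right (pow_le_pow_left₀ hy.1.le hy.2.le m) (by positivity)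

lemma GG_contDiff (k : ℕ) : ∀ e : ℤ, ContDiffOn ℝ k (GG e) (Ioo 0 1) := by
  induction k with
  | zero =>
    intro e
    simp only [Nat.cast_zero, contDiffOn_zero]
    exact fun t ht => (GG_hasDerivAt e ht).continuousAt.continuousWithinAt
  | succ k ih =>
    intro e
    push_cast
    rw [contDiffOn_succ_iff_deriv_of_isOpen isOpen_Ioo]
    refine ⟨fun t ht => (GG_hasDerivAt e ht).differentiableAt.differentiableWithinAt,
      fun h => by simp at h, ?_⟩
    refine ((ih (e+1)).div contDiffOn_id fun t ht => ht.1.ne').congr fun t ht => ?_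
    exact (GG_hasDerivAt e ht).deriv

lemma GG_zero {t : ℝ} (ht : t ∈ Ioo (0:ℝ) 1) : GG 0 t = t / (1 - t) := by
  simp only [GG, zpow_zero, mul_one, pow_succ]
  rw [tsum_mul_right, tsum_geometric_of_lt_one ht.1.le ht.2]
  ring

lemma GG_neg_one {t : ℝ} (ht : t ∈ Ioo (0:ℝ) 1) : GG (-1) t = - Real.log (1 - t) := by
  rw [← (Real.hasSum_pow_div_log_of_abs_lt_one
    (by rw [abs_of_pos ht.1]; exact ht.2 : |t| < 1)).tsum_eq, GG]
  exact tsum_congr fun m => by rw [zpow_neg_one, div_eq_mul_inv]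

lemma SA_GG_nat (k : ℕ) : SA (GG k) := by
  induction k with
  | zero =>
    refine ⟨1, (SB.const 1).mul_id.congr fun t ht => ?_⟩
    have : (1 - t) ≠ 0 := by linarith [ht.2]
    rw [Nat.cast_zero, GG_zero ht]
    field_simp
  | succ k ih =>
    refine (ih.theta fun t ht => GG_hasDerivAt k ht).congr fun t ht => ?_
    have := ht.1.ne'
    push_cast
    field_simp

lemma SA_shift (f : ℤ →₀ ℝ) (h : SA (fun t => ∑ i ∈ f.support, f i * GG i t)) (j : ℕ) :
    SA (fun t => ∑ i ∈ f.support, f i * GG (i + j) t) := by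
  induction j with
  | zero => simpa using h
  | succ j ih =>
    refine (ih.theta fun t ht => HasDerivAt.fun_sum fun i _ =>
      (GG_hasDerivAt (i + j) ht).const_mul (f i)).congr fun t ht => ?_
    have := ht.1.ne'
    rw [Finset.mul_sum]
    refine Finset.sum_congr rfl fun i _ => ?_
    push_cast
    rw [← add_assoc]
    field_simp

lemma neg_coeff_zero (f : ℤ →₀ ℝ) (h : SA (fun t => ∑ i ∈ f.support, f i * GG i t)) :
    ∀ i : ℤ, i < 0 → f i = 0 := by
  intro i hi
  by_contra hne
  have hne' : f.support.Nonempty := ⟨i, by simpa using hne⟩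
  obtain ⟨d, hd, hmin⟩ := f.support.exists_min_image id hne'
  simp only [id] at hmin
  have hd0 : d < 0 := (hmin i (by simpa using hne)).trans_lt hi
  obtain ⟨j, hj⟩ := Int.eq_ofNat_of_zero_le (show 0 ≤ -d - 1 by omega)
  have h1 := SA_shift f h j
  have h2 : SA (fun t => ∑ i ∈ f.support.erase d, f i * GG (i + j) t) := by
    refine SA.sum _ _ fun i hi => SA.smul _ ?_
    rw [Finset.mem_erase] at hi
    have := hmin i hi.2
    obtain ⟨l, hl⟩ := Int.eq_ofNat_of_zero_le (show 0 ≤ i + j by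
      have := hi.1; omega)
    rw [hl]
    exact SA_GG_nat l
  refine not_SA_log (((h1.add (h2.smul (-1))).smul (f d)⁻¹).congr fun t ht => ?_)
  rw [← Finset.add_sum_erase _ _ hd, ← GG_neg_one ht, show d + (j:ℤ) = -1 by omega]
  have : f d ≠ 0 := by simpa using hd
  field_simp
  ring

lemma SB_of_contDiff {φ : ℝ → ℝ} (hφ : ContDiffOn ℝ (⊤ : ℕ∞) φ (Ioo 0 1))
    (hder : ∀ h : ℕ, ∃ M : ℝ, ∀ t ∈ Ioo (0 : ℝ) 1, |iteratedDeriv h φ t| ≤ M) : SB φ := by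
  have hs : ∀ k, ContDiffOn ℝ (⊤ : ℕ∞) (iteratedDeriv k φ) (Ioo 0 1) := by
    intro k
    induction k with
    | zero => simpa using hφ
    | succ k ih =>
      rw [iteratedDeriv_succ]
      exact ((contDiffOn_infty_iff_deriv_of_isOpen isOpen_Ioo).1 ih).2
  refine ⟨fun k => iteratedDeriv k φ, fun t _ => by simp, fun k t ht => ?_, hder⟩
  simp only [iteratedDeriv_succ]
  exact ((((contDiffOn_infty_iff_deriv_of_isOpen isOpen_Ioo).1 (hs k)).1 t
    ht).differentiableAt (isOpen_Ioo.mem_nhds ht)).hasDerivAt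

lemma growth (n : ℕ) (p : ℤ →₀ ℝ) (C : ℝ)
    (h : ∀ m : ℕ, 1 ≤ m → |p.sum fun i c => c * (m : ℝ) ^ i| ≤ C * (m : ℝ) ^ ((n : ℤ) - 1)) :
    ∀ i : ℤ, n ≤ i → p i = 0 := by
  intro i hi
  by_contra hne
  have hne' : p.support.Nonempty := ⟨i, by simpa using hne⟩
  obtain ⟨d, hd, hmax⟩ := p.support.exists_max_image id hne'
  simp only [id] at hmax
  have hdn : (n:ℤ) ≤ d := hi.trans (hmax i (by simpa using hne))
  have lim0 : ∀ e : ℤ, e < 0 → Tendsto (fun m : ℕ => (m:ℝ) ^ e) atTop (nhds 0) := fun e he =>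
    (tendsto_zpow_atTop_zero he).comp tendsto_natCast_atTop_atTop
  have l1 : Tendsto (fun m : ℕ => ∑ i ∈ p.support, p i * (m:ℝ) ^ (i - d)) atTop
      (nhds (∑ i ∈ p.support, if i = d then p d else 0)) := by
    refine tendsto_finsetSum _ fun i hi => ?_
    split_ifs with hid
    · subst hid; simp
    · have := hmax i hi
      simpa using (lim0 (i - d) (by omega)).const_mul (p i)
  have l2 : Tendsto (fun m : ℕ => ∑ i ∈ p.support, p i * (m:ℝ) ^ (i - d)) atTop (nhds 0) := by
    refine squeeze_zero_norm' ?_ (by simpa using (lim0 ((n:ℤ) - 1 - d) (by omega)).const_mul C)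
    filter_upwards [eventually_ge_atTop 1] with m hm
    have hm0 : (0:ℝ) < m := by exact_mod_cast hm
    have e : ∑ i ∈ p.support, p i * (m:ℝ) ^ (i - d)
        = (p.sum fun i c => c * (m : ℝ) ^ i) * ((m:ℝ) ^ d)⁻¹ := by
      rw [Finsupp.sum, Finset.sum_mul]
      refine Finset.sum_congr rfl fun i _ => ?_
      rw [zpow_sub₀ hm0.ne']; ring
    rw [e, Real.norm_eq_abs, abs_mul, abs_of_pos (by positivity : 0 < ((m:ℝ) ^ d)⁻¹),
      zpow_sub₀ hm0.ne', div_eq_mul_inv, ← mul_assoc]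
    exact mul_le_mul_of_nonneg_right (h m hm) (by positivity)
  have := tendsto_nhds_unique l1 l2
  rw [Finset.sum_ite_eq' p.support d, if_pos hd] at this
  simp [this] at hd

/-- The analytic content of the first assertion of Theorem 1.1: if
`T_m = ∑_h f(h) m^h` (finite Laurent expression) satisfies
`|T_m - m^n| ≤ C m^(n-1)` and all iterated derivatives of
`φ(t) = (1-t)^(n+1) ∑_{m≥1} t^m T_m` are bounded on `(0,1)`, then `T_m` is a
monic polynomial in `m` of degree `n`. -/
theorem finite_tycz_is_monic_polynomial (n : ℕ) (f : ℤ →₀ ℝ)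
    (hbd : ∃ C : ℝ, 0 < C ∧ ∀ m : ℕ, 1 ≤ m →
      |(f.sum fun i c => c * (m : ℝ) ^ i) - (m : ℝ) ^ n| ≤ C * (m : ℝ) ^ ((n : ℤ) - 1))
    (hder : ∀ h : ℕ, ∃ M : ℝ, ∀ t ∈ Set.Ioo (0 : ℝ) 1,
      |iteratedDeriv h
        (fun t : ℝ => (1 - t) ^ (n + 1) *
          ∑' m : ℕ, t ^ (m + 1) * (f.sum fun i c => c * ((m : ℝ) + 1) ^ i)) t| ≤ M) :
    (∀ i : ℤ, i < 0 → f i = 0) ∧ (∀ i : ℤ, (n : ℤ) < i → f i = 0) ∧ f (n : ℤ) = 1 := by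
  have hneg : ∀ i : ℤ, i < 0 → f i = 0 := by
    apply neg_coeff_zero
    have heq : ∀ t ∈ Ioo (0:ℝ) 1,
        (∑' m : ℕ, t ^ (m + 1) * (f.sum fun i c => c * ((m : ℝ) + 1) ^ i))
          = ∑ i ∈ f.support, f i * GG i t := by
      intro t ht
      simp only [GG, ← tsum_mul_left]
      rw [← Summable.tsum_finsetSum fun i _ => (GG_summable i ht).mul_left (f i)]
      refine tsum_congr fun m => ?_
      rw [Finsupp.sum, Finset.mul_sum]
      exact Finset.sum_congr rfl fun i _ => by ring
    refine ⟨n + 1, (SB_of_contDiff ?_ hder).congr fun t ht => by rw [heq t ht]⟩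
    have hc : ContDiffOn ℝ (⊤ : ℕ∞)
        (fun t : ℝ => (1 - t) ^ (n + 1) * ∑ i ∈ f.support, f i * GG i t) (Ioo 0 1) := by
      refine ContDiffOn.mul (ContDiff.contDiffOn (by fun_prop)) (ContDiffOn.sum fun i _ => ?_)
      exact contDiffOn_const.mul (contDiffOn_infty.2 fun k => GG_contDiff k i)
    exact hc.congr fun t ht => by rw [heq t ht]
  obtain ⟨C, -, hC⟩ := hbd
  have hp := growth n (f - Finsupp.single (n:ℤ) 1) C (fun m hm => by
    rw [Finsupp.sum_sub_index (fun i a b => by ring), Finsupp.sum_single_index (by simp)]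
    simpa using hC m hm)
  refine ⟨hneg, fun i hi => ?_, ?_⟩
  · have := hp i hi.le
    rwa [Finsupp.sub_apply, Finsupp.single_eq_of_ne (by omega), sub_zero] at this
  · have := hp n le_rfl
    rw [Finsupp.sub_apply, Finsupp.single_eq_same] at this
    linarith
end

section
/- Let a > 0, let f : (0,a) → ℝ be a smooth function, let ψ be a real polynomial, and set y(r) = r·f'(r). Assume r·y'(r) = ψ(y(r)) for all r ∈ (0,a). Then for every integer k ≥ 1 there exists a real polynomial P_k such that for all r ∈ (0,a): e^{−f(r)} · (d^k/dr^k) e^{f(r)} = r^{−k} · [ ψ(y(r))·P_k(y(r)) + ∏_{i=0}^{k−1} (y(r) − i) ]. -/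
open Set

/-- Formula (formulaiND) of Lemma 3.3: for a smooth `f` on `(0,a)` with
`y(r) = r f'(r)` satisfying `r y'(r) = ψ(y(r))`, for every `k ≥ 1` there is a
polynomial `P_k` such that
`e^{-f} (d^k/dr^k) e^{f} = (ψ(y) P_k(y) + y(y-1)⋯(y-k+1)) / r^k`. -/
theorem derivative_formula_radial_potential
    (a : ℝ) (ha : 0 < a) (f : ℝ → ℝ) (hf : ContDiffOn ℝ (⊤ : ℕ∞) f (Set.Ioo 0 a))
    (ψ : Polynomial ℝ) (y : ℝ → ℝ)
    (hy : ∀ r ∈ Set.Ioo (0 : ℝ) a, y r = r * deriv f r)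
    (hode : ∀ r ∈ Set.Ioo (0 : ℝ) a, r * deriv y r = ψ.eval (y r)) :
    ∀ k : ℕ, 1 ≤ k → ∃ P : Polynomial ℝ, ∀ r ∈ Set.Ioo (0 : ℝ) a,
      Real.exp (-(f r)) * iteratedDeriv k (fun s : ℝ => Real.exp (f s)) r =
        (ψ.eval (y r) * P.eval (y r) +
          ∏ i ∈ Finset.range k, (y r - (i : ℝ))) / r ^ k := by
  have hyd : ∀ r ∈ Set.Ioo (0 : ℝ) a, HasDerivAt y (ψ.eval (y r) / r) r := by
    intro r hr
    have hr0 : r ≠ 0 := hr.1.ne'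
    have hev : y =ᶠ[nhds r] fun s => s * deriv f s := by
      filter_upwards [isOpen_Ioo.mem_nhds hr] with s hs using hy s hs
    have h2 : DifferentiableAt ℝ (deriv f) r := by
      have h3 : ContDiffOn ℝ 1 (deriv f) (Set.Ioo 0 a) :=
        hf.deriv_of_isOpen isOpen_Ioo (WithTop.coe_le_coe.mpr (le_top : (1 + 1 : ℕ∞) ≤ ⊤))
      exact (h3.differentiableOn (by norm_num)).differentiableAt (isOpen_Ioo.mem_nhds hr)
    have h1 : DifferentiableAt ℝ y r :=
      hev.differentiableAt_iff.mpr (differentiableAt_id.mul h2)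
    have h4 := h1.hasDerivAt
    rwa [show deriv y r = ψ.eval (y r) / r by rw [← hode r hr]; field_simp] at h4
  have hfd : ∀ r ∈ Set.Ioo (0 : ℝ) a, HasDerivAt f (y r / r) r := by
    intro r hr
    have hr0 : r ≠ 0 := hr.1.ne'
    have h1 : DifferentiableAt ℝ f r :=
      (hf.differentiableOn (by simp)).differentiableAt (isOpen_Ioo.mem_nhds hr)
    have h4 := h1.hasDerivAt
    rwa [show deriv f r = y r / r by rw [hy r hr]; field_simp] at h4
  have key : ∀ k : ℕ, ∃ P : Polynomial ℝ, ∀ r ∈ Set.Ioo (0 : ℝ) a,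
      iteratedDeriv k (fun s : ℝ => Real.exp (f s)) r =
        Real.exp (f r) * ((ψ * P + ∏ i ∈ Finset.range k,
          (Polynomial.X - Polynomial.C (i : ℝ))).eval (y r) / r ^ k) := by
    intro k
    induction k with
    | zero => exact ⟨0, fun r _ => by simp⟩
    | succ k ih =>
      obtain ⟨P, hP⟩ := ih
      set F : Polynomial ℝ := ∏ i ∈ Finset.range k,
          (Polynomial.X - Polynomial.C (i : ℝ)) with hF
      refine ⟨(Polynomial.X - Polynomial.C (k : ℝ)) * P +
        Polynomial.derivative (ψ * P + F), fun r hr => ?_⟩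
      have hr0 : r ≠ 0 := hr.1.ne'
      rw [iteratedDeriv_succ, Finset.prod_range_succ, ← hF]
      generalize hQ : ψ * P + F = Q at *
      have hev : iteratedDeriv k (fun s : ℝ => Real.exp (f s)) =ᶠ[nhds r]
          fun s => Real.exp (f s) * (Q.eval (y s) / s ^ k) := by
        filter_upwards [isOpen_Ioo.mem_nhds hr] with s hs using hP s hs
      rw [hev.deriv_eq]
      have hq : HasDerivAt (fun s => Q.eval (y s))
          (Q.derivative.eval (y r) * (ψ.eval (y r) / r)) r :=
        (Q.hasDerivAt (y r)).comp r (hyd r hr)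
      have hd := (hfd r hr).exp.mul (hq.div (hasDerivAt_pow k r) (pow_ne_zero k hr0))
      refine hd.deriv.trans ?_
      have hQF : F = Q - ψ * P := by rw [← hQ]; ring
      rw [hQF]
      have hk : (k : ℝ) * r ^ (k - 1) = k * r ^ k / r := by
        cases k with
        | zero => simp
        | succ n => rw [pow_succ]; field_simp; simp
      rw [hk]
      simp only [Polynomial.eval_add, Polynomial.eval_mul, Polynomial.eval_sub,
        Polynomial.eval_X, Polynomial.eval_C, Pi.div_apply]
      field_simp
      ring
  intro k _
  obtain ⟨P, hP⟩ := key k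
  refine ⟨P, fun r hr => ?_⟩
  rw [hP r hr, ← mul_assoc, ← Real.exp_add]
  simp [Polynomial.eval_prod]
end

section
/- Let A, B be real numbers and let S ⊆ (0, +∞) be a set having 0 as a limit point (0 lies in the closure of S). If for every y ∈ S both (A+1)y² + B ≥ 0 and (2Ay + 3y − 2)(Ay² + y + B) + 2y − 3y² + y³ ≥ 0 hold, then B = 0. -/
/-- Analytic core of Lemma 3.2: if `S ⊆ (0,∞)` has `0` as a limit point and both
`(A+1)y² + B ≥ 0` and `(2Ay + 3y - 2)(Ay² + y + B) + 2y - 3y² + y³ ≥ 0` hold on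
`S`, then `B = 0`. -/
theorem B_eq_zero_of_limit_point (A B : ℝ) (S : Set ℝ) (hS : S ⊆ Set.Ioi 0)
    (h0 : (0 : ℝ) ∈ closure S)
    (h1 : ∀ y ∈ S, 0 ≤ (A + 1) * y ^ 2 + B)
    (h2 : ∀ y ∈ S,
      0 ≤ (2 * A * y + 3 * y - 2) * (A * y ^ 2 + y + B) + 2 * y - 3 * y ^ 2 + y ^ 3) :
    B = 0 := by
  have c1 : IsClosed {y : ℝ | 0 ≤ (A + 1) * y ^ 2 + B} :=
    isClosed_le (by fun_prop) (by fun_prop)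
  have c2 : IsClosed {y : ℝ |
      0 ≤ (2 * A * y + 3 * y - 2) * (A * y ^ 2 + y + B) + 2 * y - 3 * y ^ 2 + y ^ 3} :=
    isClosed_le (by fun_prop) (by fun_prop)
  have e1 : 0 ≤ (A + 1) * (0:ℝ) ^ 2 + B := closure_minimal (fun y hy => h1 y hy) c1 h0
  have e2 : 0 ≤ (2 * A * 0 + 3 * 0 - 2) * (A * 0 ^ 2 + 0 + B) + 2 * 0 - 3 * 0 ^ 2 + (0:ℝ) ^ 3 :=
    closure_minimal (fun y hy => h2 y hy) c2 h0
  norm_num at e1 e2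
  linarith
end

section
/- Let μ, λ, ξ > 0 be real numbers and define f(r) = (μλ/2)·log r − μ·log(1 − ξ r^{λ+1}) for 0 < r < ξ^{−1/(λ+1)}. Then for all such r: f'(r)·(f'(r) + r·f''(r)) = (ξ μ² (λ+1)² / 2) · r^{λ−1} · [λ + ξ(λ+2) r^{λ+1}] / (1 − ξ r^{λ+1})³. -/
/-- Formula (detg): for
`f(r) = (μλ/2) log r - μ log(1 - ξ r^(λ+1))` on `0 < r < ξ^(-1/(λ+1))`,
`f'(r)(f'(r) + r f''(r)) = (ξμ²(λ+1)²/2) r^(λ-1) (λ + ξ(λ+2) r^(λ+1)) / (1 - ξ r^(λ+1))³`. -/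
theorem detg_formula (μ l ξ : ℝ) (hμ : 0 < μ) (hl : 0 < l) (hξ : 0 < ξ)
    (f : ℝ → ℝ)
    (hf : ∀ r ∈ Set.Ioo (0 : ℝ) (ξ ^ (-1 / (l + 1))),
      f r = μ * l / 2 * Real.log r - μ * Real.log (1 - ξ * r ^ (l + 1))) :
    ∀ r ∈ Set.Ioo (0 : ℝ) (ξ ^ (-1 / (l + 1))),
      deriv f r * (deriv f r + r * deriv (deriv f) r) =
        ξ * μ ^ 2 * (l + 1) ^ 2 / 2 * r ^ (l - 1) *
          (l + ξ * (l + 2) * r ^ (l + 1)) / (1 - ξ * r ^ (l + 1)) ^ 3 := by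
  have hl1 : 0 < l + 1 := by linarith
  have key : ∀ r ∈ Set.Ioo (0 : ℝ) (ξ ^ (-1 / (l + 1))), 0 < 1 - ξ * r ^ (l + 1) := by
    intro r hr
    have h1 : r ^ (l + 1) < (ξ ^ (-1 / (l + 1))) ^ (l + 1) :=
      Real.rpow_lt_rpow hr.1.le hr.2 hl1
    have h3 : -1 / (l + 1) * (l + 1) = -1 := by field_simp
    rw [← Real.rpow_mul hξ.le, h3, Real.rpow_neg_one] at h1
    have h2 : ξ * r ^ (l + 1) < ξ * ξ⁻¹ := mul_lt_mul_of_pos_left h1 hξ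
    rw [mul_inv_cancel₀ hξ.ne'] at h2
    linarith
  have hu : ∀ r : ℝ, 0 < r →
      HasDerivAt (fun r : ℝ => 1 - ξ * r ^ (l + 1)) (-(ξ * ((l + 1) * r ^ l))) r := by
    intro r hr
    have h := ((Real.hasDerivAt_rpow_const (x := r) (p := l + 1)
      (Or.inl hr.ne')).const_mul ξ).const_sub 1
    simpa using h
  have hd : ∀ r ∈ Set.Ioo (0 : ℝ) (ξ ^ (-1 / (l + 1))),
      deriv f r = μ * l / 2 * r⁻¹ -
        μ * (-(ξ * ((l + 1) * r ^ l)) / (1 - ξ * r ^ (l + 1))) := by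
    intro r hr
    have he : f =ᶠ[nhds r] fun r =>
        μ * l / 2 * Real.log r - μ * Real.log (1 - ξ * r ^ (l + 1)) := by
      filter_upwards [isOpen_Ioo.mem_nhds hr] with x hx using hf x hx
    rw [he.deriv_eq]
    exact (((Real.hasDerivAt_log hr.1.ne').const_mul _).sub
      (((hu r hr.1).log (key r hr).ne').const_mul μ)).deriv
  intro r hr
  have he : deriv f =ᶠ[nhds r] fun r => μ * l / 2 * r⁻¹ -
        μ * (-(ξ * ((l + 1) * r ^ l)) / (1 - ξ * r ^ (l + 1))) := by
    filter_upwards [isOpen_Ioo.mem_nhds hr] with x hx using hd x hx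
  have hdd := (((hasDerivAt_inv hr.1.ne').const_mul (μ * l / 2)).sub
    (((((((Real.hasDerivAt_rpow_const (x := r) (p := l)
      (Or.inl hr.1.ne')).const_mul (l + 1)).const_mul ξ).fun_neg).fun_div (hu r hr.1)
      (key r hr).ne')).const_mul μ)).deriv
  have hk := key r hr
  have hr0 := hr.1
  rw [he.deriv_eq, hd r hr]
  erw [hdd]
  have e1 : r ^ (l + 1) = r ^ (l - 1) * r ^ 2 := by
    rw [← Real.rpow_natCast r 2, ← Real.rpow_add hr0]; congr 1; push_cast; ring
  have e2 : r ^ l = r ^ (l - 1) * r := by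
    nth_rewrite 3 [← Real.rpow_one r]
    rw [← Real.rpow_add hr0]; congr 1; ring
  rw [e1] at hk ⊢
  rw [e2]
  generalize r ^ (l - 1) = y at *
  have hk' := hk.ne'
  have hk2 : 1 - ξ * y * r ^ 2 ≠ 0 := by rwa [mul_assoc]
  have hk3 : 1 - r ^ 2 * ξ * y ≠ 0 := by convert hk' using 1; ring
  have hk4 : 1 - r ^ 2 * y * ξ ≠ 0 := by convert hk' using 1; ring
  have hk5 : 1 - ξ * r ^ 2 * y ≠ 0 := by convert hk' using 1; ring
  field_simp
  ring
end

section
/- Let μ > 0 and 0 < ζ < 1 be real numbers. The function y(t) = μ·[ −ζ e^{−ζt} / (1 + e^{−ζt}) + (1+ζ)/2 ] satisfies the differential equation y'(t) = −(1/μ)·(y(t) − μ(1+ζ)/2)·(y(t) − μ(1−ζ)/2) for all t ∈ ℝ, and moreover μ(1−ζ)/2 < y(t) < μ(1+ζ)/2 for all t. -/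
/-- Case (An0vii): the function
`y(t) = μ [-ζ e^{-ζt}/(1 + e^{-ζt}) + (1+ζ)/2]` satisfies
`y' = -(1/μ)(y - μ(1+ζ)/2)(y - μ(1-ζ)/2)` on `ℝ`, and
`μ(1-ζ)/2 < y(t) < μ(1+ζ)/2` for all `t`. -/
theorem case_An0vii_solution (μ ζ : ℝ) (hμ : 0 < μ) (hζ0 : 0 < ζ) (hζ1 : ζ < 1)
    (y : ℝ → ℝ)
    (hy : ∀ t : ℝ, y t =
      μ * (-(ζ * Real.exp (-(ζ * t))) / (1 + Real.exp (-(ζ * t))) + (1 + ζ) / 2)) :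
    ∀ t : ℝ,
      deriv y t = -(1 / μ) * (y t - μ * (1 + ζ) / 2) * (y t - μ * (1 - ζ) / 2) ∧
      μ * (1 - ζ) / 2 < y t ∧ y t < μ * (1 + ζ) / 2 := by
  intro t
  have hE : 0 < Real.exp (-(ζ * t)) := Real.exp_pos _
  have hexp : HasDerivAt (fun s : ℝ => Real.exp (-(ζ * s)))
      (Real.exp (-(ζ * t)) * (-(ζ * 1))) t :=
    (((hasDerivAt_id t).const_mul ζ).neg).exp
  have hne : 1 + Real.exp (-(ζ * t)) ≠ 0 := by positivity
  have hd := ((((hexp.const_mul ζ).fun_neg).fun_div (hexp.const_add 1) hne).add_const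
    ((1 + ζ) / 2)).const_mul μ
  have hyf : y = fun t => μ * (-(ζ * Real.exp (-(ζ * t))) / (1 + Real.exp (-(ζ * t)))
      + (1 + ζ) / 2) := funext hy
  have hder := hd.deriv
  rw [← hyf] at hder
  rw [hder, hy t]
  generalize Real.exp (-(ζ * t)) = E at *
  have h1 : μ * (-(ζ * E) / (1 + E) + (1 + ζ) / 2) - μ * (1 + ζ) / 2
      = -(μ * ζ * E / (1 + E)) := by
    field_simp
    ring
  have h2 : μ * (-(ζ * E) / (1 + E) + (1 + ζ) / 2) - μ * (1 - ζ) / 2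
      = μ * ζ / (1 + E) := by
    field_simp
    ring
  have p1 : 0 < μ * ζ * E / (1 + E) := by positivity
  have p2 : 0 < μ * ζ / (1 + E) := by positivity
  refine ⟨?_, by linarith, by linarith⟩
  rw [h1, h2]
  field_simp
  ring
end

section
/- Let λ be a positive integer and μ, ξ > 0 real numbers such that N := μλ/2 is a positive integer. Then there do not exist ε > 0, C > 0, and strictly positive real numbers b_{jk}, one for each pair (j,k) of natural numbers with j + k > N − (λ+1), such that for all x, y ∈ [0, ε) the series Σ_{j+k > N−(λ+1)} b_{jk} x^j y^k converges and equals C·(x+y)^N / (1 − ξ(x+y)^{λ+1})^{μ}. -/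
/-- Obstruction (defbalanced3): the metric of case (An0v) is not balanced.
There are no `ε, C > 0` and positive coefficients `b_{jk}` (for `j+k > N-(λ+1)`)
such that `∑ b_{jk} x^j y^k = C (x+y)^N / (1 - ξ(x+y)^{λ+1})^μ` on `[0,ε)²`. -/
theorem not_balanced_An0v (l : ℕ) (hl : 0 < l) (μ ξ : ℝ) (hμ : 0 < μ) (hξ : 0 < ξ)
    (N : ℕ) (hN : 0 < N) (hNdef : μ * l / 2 = N) :
    ¬ ∃ (ε C : ℝ) (b : ℕ → ℕ → ℝ), 0 < ε ∧ 0 < C ∧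
      (∀ j k : ℕ, (N : ℤ) - (l + 1) < (j : ℤ) + k → 0 < b j k) ∧
      ∀ x y : ℝ, x ∈ Set.Ico (0 : ℝ) ε → y ∈ Set.Ico (0 : ℝ) ε →
        HasSum
          (fun p : ℕ × ℕ =>
            if (N : ℤ) - (l + 1) < (p.1 : ℤ) + p.2 then b p.1 p.2 * x ^ p.1 * y ^ p.2
            else 0)
          (C * (x + y) ^ N / (1 - ξ * (x + y) ^ (l + 1)) ^ μ) := by
  rintro ⟨ε, C, b, hε, hC, hb, h⟩
  obtain ⟨n, rfl⟩ : ∃ n, N = n + 1 := ⟨N - 1, by omega⟩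
  have hbn : 0 < b n 0 := hb n 0 (by push_cast; omega)
  have key : ∀ x ∈ Set.Ioo (0 : ℝ) ε,
      b n 0 ≤ C * x / (1 - ξ * x ^ (l + 1)) ^ μ := by
    intro x hx
    have hs := h x 0 ⟨hx.1.le, hx.2⟩ ⟨le_refl _, hε⟩
    have hle := le_hasSum hs (n, 0) (by
      intro p _
      split_ifs with hp
      · have h1 := (hb p.1 p.2 hp).le
        have h2 := pow_nonneg hx.1.le p.1
        have h3 : (0 : ℝ) ≤ 0 ^ p.2 := pow_nonneg le_rfl _
        exact mul_nonneg (mul_nonneg h1 h2) h3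
      · exact le_rfl)
    dsimp only at hle
    rw [if_pos (by push_cast; omega)] at hle
    rw [pow_zero, mul_one, add_zero] at hle
    have hpos : 0 < x ^ n := pow_pos hx.1 n
    have e : C * x ^ (n + 1) / (1 - ξ * x ^ (l + 1)) ^ μ
        = (C * x / (1 - ξ * x ^ (l + 1)) ^ μ) * x ^ n := by ring
    rw [e] at hle
    exact le_of_mul_le_mul_right hle hpos
  have hcont : ContinuousAt (fun x : ℝ => C * x / (1 - ξ * x ^ (l + 1)) ^ μ) 0 := by
    apply ContinuousAt.div
    · fun_prop
    · apply ContinuousAt.rpow_const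
      · fun_prop
      · left; simp
    · simp
  have ht : Filter.Tendsto (fun x : ℝ => C * x / (1 - ξ * x ^ (l + 1)) ^ μ)
      (nhdsWithin 0 (Set.Ioi 0)) (nhds 0) := by
    have := hcont.tendsto
    simp only [mul_zero, zero_div] at this
    exact this.mono_left nhdsWithin_le_nhds
  have := ge_of_tendsto ht (Filter.mem_of_superset (Ioo_mem_nhdsGT hε) key)
  linarith
end

section
/- Let μ, ξ, λ > 0 be real numbers with λ not an integer and such that N := μλ/2 is a positive integer. Define G(r) = r^N (1 − ξ r^{λ+1})^{−μ} = Σ_{i=0}^{∞} (μ(μ+1)⋯(μ+i−1)/i!) ξ^i r^{(λ+1)i + N} for 0 < r < ξ^{−1/(λ+1)}. Then, with k₀ = N + ⌊λ⌋ + 3 (where ⌊λ⌋ is the integer part of λ), the k₀-th derivative of G satisfies lim_{r → 0⁺} G^{(k₀)}(r) = −∞. -/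
open Filter

lemma aux_step (e : ℝ) (he : 0 < e) (a : ℝ) (G F : ℝ → ℝ) (hF : AnalyticAt ℝ F 0)
    (hG : ∀ᶠ r in nhdsWithin (0:ℝ) (Set.Ioi 0), G r = r ^ a * F (r ^ e)) :
    ∀ᶠ r in nhdsWithin (0:ℝ) (Set.Ioi 0),
      deriv G r = r ^ (a - 1) * (a * F (r ^ e) + e * (r ^ e * deriv F (r ^ e))) := by
  have hlim : Tendsto (fun r : ℝ => r ^ e) (nhdsWithin (0:ℝ) (Set.Ioi 0)) (nhds 0) := by
    have h := (Real.continuousAt_rpow_const 0 e (Or.inr he.le)).tendsto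
    rw [Real.zero_rpow he.ne'] at h
    exact h.mono_left nhdsWithin_le_nhds
  have h1 := hlim.eventually hF.eventually_analyticAt
  have h2 := eventually_eventually_nhdsWithin.mpr hG
  filter_upwards [h1, h2, self_mem_nhdsWithin] with r hr1 hr2 hr
  have hr0 : (0:ℝ) < r := hr
  rw [isOpen_Ioi.nhdsWithin_eq hr] at hr2
  have heq : G =ᶠ[nhds r] fun r => r ^ a * F (r ^ e) := hr2
  rw [heq.deriv_eq]
  have d1 := Real.hasDerivAt_rpow_const (x := r) (p := a) (Or.inl hr0.ne')
  have d2 := Real.hasDerivAt_rpow_const (x := r) (p := e) (Or.inl hr0.ne')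
  have d3 := hr1.differentiableAt.hasDerivAt.comp r d2
  have d4 := (d1.mul d3).deriv
  have : deriv (fun r : ℝ => r ^ a * F (r ^ e)) r = _ := d4
  rw [this]
  simp only [Function.comp]
  rw [Real.rpow_sub_one hr0.ne', Real.rpow_sub_one hr0.ne']
  field_simp

lemma aux_iter (e : ℝ) (he : 0 < e) (a : ℝ) (G F : ℝ → ℝ) (hF : AnalyticAt ℝ F 0)
    (hG : ∀ᶠ r in nhdsWithin (0:ℝ) (Set.Ioi 0), G r = r ^ a * F (r ^ e)) (k : ℕ) :
    ∃ H : ℝ → ℝ, AnalyticAt ℝ H 0 ∧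
      H 0 = (∏ j ∈ Finset.range k, (a - j)) * F 0 ∧
      deriv H 0 = (∏ j ∈ Finset.range k, (a + e - j)) * deriv F 0 ∧
      ∀ᶠ r in nhdsWithin (0:ℝ) (Set.Ioi 0),
        iteratedDeriv k G r = r ^ (a - k) * H (r ^ e) := by
  induction k with
  | zero => exact ⟨F, hF, by simp, by simp, by simpa using hG⟩
  | succ k ih =>
    obtain ⟨H, hH, h0, h1, h2⟩ := ih
    refine ⟨fun y => (a - k) * H y + e * (y * deriv H y), ?_, ?_, ?_, ?_⟩
    · exact (analyticAt_const.mul hH).add (analyticAt_const.mul (analyticAt_id.mul hH.deriv))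
    · simp only [h0, Finset.prod_range_succ]; ring
    · have d1 := hH.differentiableAt.hasDerivAt
      have d2 := hH.deriv.differentiableAt.hasDerivAt
      have d3 := ((d1.const_mul (a - k)).add (((hasDerivAt_id (0:ℝ)).mul d2).const_mul e)).deriv
      refine Eq.trans d3 ?_
      rw [Finset.prod_range_succ, h1]
      simp only [id]
      ring
    · have h3 := aux_step e he (a - k) _ H hH h2
      filter_upwards [h3] with r hr
      rw [iteratedDeriv_succ, hr]
      push_cast
      rw [sub_sub]

/-- Case (An0v) with `λ ∉ ℤ` is not projectively induced: for
`G(r) = r^N (1 - ξ r^{λ+1})^{-μ}` with `N = μλ/2` a positive integer and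
`k₀ = N + ⌊λ⌋ + 3`, one has `G^{(k₀)}(r) → -∞` as `r → 0⁺`. -/
theorem case_An0v_derivative_diverges (μ ξ l : ℝ)
    (hμ : 0 < μ) (hξ : 0 < ξ) (hl : 0 < l) (hlZ : ∀ m : ℤ, l ≠ (m : ℝ))
    (N : ℕ) (hN : 0 < N) (hNdef : μ * l / 2 = N)
    (G : ℝ → ℝ)
    (hG : ∀ r ∈ Set.Ioo (0 : ℝ) (ξ ^ (-1 / (l + 1))),
      G r = r ^ N * (1 - ξ * r ^ (l + 1)) ^ (-μ)) :
    Filter.Tendsto (iteratedDeriv (N + (⌊l⌋).toNat + 3) G)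
      (nhdsWithin 0 (Set.Ioi 0)) Filter.atBot := by
  have he : 0 < l + 1 := by linarith
  obtain ⟨M, hM⟩ : ∃ M : ℕ, (⌊l⌋).toNat = M := ⟨_, rfl⟩
  have hfl : ((M:ℤ)) = ⌊l⌋ := by
    rw [← hM]; exact Int.toNat_of_nonneg (Int.floor_nonneg.mpr hl.le)
  have hfl' : (M:ℝ) = (⌊l⌋ : ℝ) := by rw [← hfl]; simp
  have hlo : (M:ℝ) < l :=
    lt_of_le_of_ne (hfl' ▸ Int.floor_le l) (fun h => hlZ M (by simpa using h.symm))
  have hhi : l < M + 1 := hfl' ▸ Int.lt_floor_add_one l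
  rw [hM]
  have hF : AnalyticAt ℝ (fun y : ℝ => (1 - ξ * y) ^ (-μ)) 0 := by
    exact (ContDiffAt.rpow (by fun_prop) contDiffAt_const (by simp)).analyticAt
  have hdF : deriv (fun y : ℝ => (1 - ξ * y) ^ (-μ)) 0 = μ * ξ := by
    have d := ((((hasDerivAt_id (0:ℝ)).const_mul ξ).const_sub 1).rpow_const (p := -μ)
      (Or.inl (by simp))).deriv
    refine Eq.trans d ?_
    simp
    ring
  have hG' : ∀ᶠ r in nhdsWithin (0:ℝ) (Set.Ioi 0),
      G r = r ^ (N:ℝ) * (fun y : ℝ => (1 - ξ * y) ^ (-μ)) (r ^ (l + 1)) := by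
    filter_upwards [Ioo_mem_nhdsGT (Real.rpow_pos_of_pos hξ (-1 / (l + 1)))] with r hr
    rw [hG r hr, Real.rpow_natCast]
  obtain ⟨H, hH, h0, h1, h2⟩ := aux_iter (l + 1) he N G _ hF hG' (N + M + 3)
  have hH0 : H 0 = 0 := by
    rw [h0, Finset.prod_eq_zero (i := N) (Finset.mem_range.mpr (by omega)) (by simp), zero_mul]
  have hc : deriv H 0 < 0 := by
    rw [h1, hdF, Finset.prod_range_succ]
    refine mul_neg_of_neg_of_pos (mul_neg_of_pos_of_neg ?_ ?_) (by positivity)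
    · refine Finset.prod_pos fun j hj => ?_
      have : (j:ℝ) ≤ N + M + 1 := by
        have : j ≤ N + M + 1 := by have := Finset.mem_range.mp hj; omega
        exact_mod_cast this
      linarith
    · push_cast; linarith
  have hlim : Tendsto (fun r : ℝ => r ^ (l + 1)) (nhdsWithin (0:ℝ) (Set.Ioi 0))
      (nhdsWithin 0 {0}ᶜ) := by
    refine tendsto_nhdsWithin_iff.mpr ⟨?_, ?_⟩
    · have h := (Real.continuousAt_rpow_const 0 (l + 1) (Or.inr he.le)).tendsto
      rw [Real.zero_rpow he.ne'] at h
      exact h.mono_left nhdsWithin_le_nhds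
    · filter_upwards [self_mem_nhdsWithin] with r hr
      exact (Real.rpow_pos_of_pos hr _).ne'
  have hs := (hasDerivAt_iff_tendsto_slope.mp hH.differentiableAt.hasDerivAt).comp hlim
  have hp : Tendsto (fun r : ℝ => r ^ (l - M - 2)) (nhdsWithin (0:ℝ) (Set.Ioi 0)) atTop :=
    tendsto_rpow_neg_nhdsGT_zero (by linarith)
  refine (hp.atTop_mul_neg hc hs).congr' ?_
  filter_upwards [h2, self_mem_nhdsWithin] with r hr hr0
  have hr0 : (0:ℝ) < r := hr0
  rw [hr]
  have hx : r ^ ((N:ℝ) - ((N + M + 3 : ℕ):ℝ)) * r ^ (l + 1) = r ^ (l - M - 2) := by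
    rw [← Real.rpow_add hr0]; congr 1; push_cast; ring
  rw [← hx]
  have := (Real.rpow_pos_of_pos hr0 (l + 1)).ne'
  simp only [Function.comp, slope_def_field, hH0, sub_zero]
  field_simp
end
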